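/- arXiv:0711.3514 — 7 statements merged into one kernel-verified Lean document; each statement's English description precedes it below -/
import Mathlib

section
/- Let r ≥ 2, q = 2r − 1, and let N be a nontrivial normal subgroup of the free group F_r on r generators, with cogrowth coefficients γ_n and cogrowth exponent γ = lim (γ_{2n})^{1/(2n)}. Then the generating function γ(z) = Σ_{n≥0} γ_n z^n (defined on its disc of convergence, which contains a neighborhood of 0) can be written as γ(z) = γ⁽⁰⁾(z) + γ⁽¹⁾(z), where γ⁽⁰⁾ is holomorphic on the open disc {|z| < q^{-1/2}} and γ⁽¹⁾ is holomorphic on ℂ with the two real intervals [−γ/q, −1/γ] and [1/γ, γ/q] removed; moreover the function Φ(z) = z·γ⁽¹⁾(z)/(1 − z²) satisfies the functional equation Φ(z) = Φ(1/(qz)) for all z ≠ 0 in its domain. -/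
open Filter

/-- The isometry of `ℓ²` induced by a permutation of the index set. -/
noncomputable def lpPermute {G : Type*} (e : Equiv.Perm G) :
    lp (fun _ : G => ℂ) 2 →L[ℂ] lp (fun _ : G => ℂ) 2 :=
  LinearIsometry.toContinuousLinearMap
    { toFun := fun f => ⟨fun g => f (e g), by
        have h := (memℓp_gen_iff (by norm_num)).1 (lp.memℓp f)
        exact (memℓp_gen_iff (by norm_num)).2 (h.comp_injective e.injective)⟩
      map_add' := fun f g => rfl
      map_smul' := fun a f => rfl
      norm_map' := fun f => by
        rw [lp.norm_eq_tsum_rpow (by norm_num), lp.norm_eq_tsum_rpow (by norm_num)]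
        congr 1
        exact e.tsum_eq fun g => ‖f g‖ ^ (2 : ENNReal).toReal }

@[simp]
theorem lpPermute_apply {G : Type*} (e : Equiv.Perm G) (f : lp (fun _ : G => ℂ) 2) (g : G) :
    lpPermute e f g = f (e g) := rfl

theorem lpPermute_mul {G : Type*} (e e' : Equiv.Perm G) :
    lpPermute (e * e') = lpPermute e' * lpPermute e := by
  ext f g
  simp

theorem star_lpPermute {G : Type*} (e : Equiv.Perm G) :
    star (lpPermute e) = lpPermute e⁻¹ := by
  rw [ContinuousLinearMap.star_eq_adjoint]
  symm
  rw [ContinuousLinearMap.eq_adjoint_iff]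
  intro f g
  rw [lp.inner_eq_tsum, lp.inner_eq_tsum, ← e.tsum_eq]
  simp

/-- The representation of a group `F` on `ℓ²` of an `F`-set. -/
noncomputable def permRep {F : Type*} (G : Type*) [Group F] [MulAction F G] (x : F) :
    lp (fun _ : G => ℂ) 2 →L[ℂ] lp (fun _ : G => ℂ) 2 :=
  lpPermute (MulAction.toPerm x⁻¹)

theorem permRep_mul {F G : Type*} [Group F] [MulAction F G] (x y : F) :
    permRep G (x * y) = permRep G x * permRep G y := by
  rw [permRep, permRep, permRep, ← lpPermute_mul]
  congr 1
  ext g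
  simp [mul_smul]

theorem star_permRep {F G : Type*} [Group F] [MulAction F G] (x : F) :
    star (permRep G x) = permRep G x⁻¹ := by
  rw [permRep, permRep, star_lpPermute]
  exact congrArg lpPermute (map_inv (MulAction.toPermHom F G) x⁻¹).symm

theorem permRep_one {F G : Type*} [Group F] [MulAction F G] :
    permRep G (1 : F) = 1 := by
  ext f g
  simp [permRep]

theorem inner_permRep_single {F G : Type*} [Group F] [MulAction F G] [DecidableEq G] (x : F)
    (g : G) :
    inner ℂ (permRep G x (lp.single 2 g (1 : ℂ))) (lp.single 2 g (1 : ℂ)) =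
      if x • g = g then 1 else 0 := by
  have h : x⁻¹ • g = g ↔ x • g = g := by rw [inv_smul_eq_iff, eq_comm]
  rw [lp.inner_single_right]
  simp [permRep, Pi.single_apply, h]

open Polynomial in
/-- Polynomials with generating function `1 / (1 - x z + q z²)`. -/
noncomputable def ballPoly (q : ℝ) : ℕ → ℝ[X]
  | 0 => 1
  | 1 => X
  | n + 2 => X * ballPoly q (n + 1) - C q * ballPoly q n

open Polynomial in
/-- Polynomials with generating function `(1 - z²) / (1 - x z + q z²)`. -/
noncomputable def spherePoly (q : ℝ) : ℕ → ℝ[X]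
  | 0 => 1
  | 1 => X
  | n + 2 => ballPoly q (n + 2) - ballPoly q n

open Polynomial in
theorem spherePoly_two (q : ℝ) : spherePoly q 2 = X * spherePoly q 1 - C (q + 1) := by
  simp only [spherePoly, ballPoly, map_add, map_one]
  ring

open Polynomial in
theorem spherePoly_add_three (q : ℝ) (n : ℕ) :
    spherePoly q (n + 3) = X * spherePoly q (n + 2) - C q * spherePoly q (n + 1) := by
  rcases n with _ | n <;> simp only [spherePoly, ballPoly] <;> ring


theorem exists_measure_integral_eval_eq_inner_aeval {H : Type*} [NormedAddCommGroup H]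
    [InnerProductSpace ℂ H] [CompleteSpace H] (A : H →L[ℂ] H) (hA : IsSelfAdjoint A) (v : H) :
    ∃ μ : MeasureTheory.Measure ℝ, MeasureTheory.IsFiniteMeasure μ ∧
      (∃ R : ℝ, ∀ᵐ x ∂μ, |x| ≤ R) ∧
      ∀ P : Polynomial ℝ,
        ∫ x, P.eval x ∂μ = (inner ℂ (Polynomial.aeval A P v) v).re := by
  have hcomp : IsCompact (spectrum ℝ A) := spectrum.isCompact A
  have : CompactSpace (spectrum ℝ A) := isCompact_iff_compactSpace.1 hcomp
  let Λ : CompactlySupportedContinuousMap (spectrum ℝ A) ℝ →ₚ[ℝ] ℝ := PositiveLinearMap.mk₀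
    { toFun := fun f => (inner ℂ (cfcHom hA (f : C(spectrum ℝ A, ℝ)) v) v).re
      map_add' := fun f g => by
        have : ((f + g : CompactlySupportedContinuousMap (spectrum ℝ A) ℝ) :
          C(spectrum ℝ A, ℝ)) = (f : C(spectrum ℝ A, ℝ)) + g := rfl
        simp [this]
      map_smul' := fun a f => by
        have : ((a • f : CompactlySupportedContinuousMap (spectrum ℝ A) ℝ) :
          C(spectrum ℝ A, ℝ)) = a • (f : C(spectrum ℝ A, ℝ)) := rfl
        rw [this, map_smul, smul_apply, ← Complex.coe_smul, inner_smul_left]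
        simp }
    (fun f hf => by
      have h : 0 ≤ cfcHom hA (f : C(spectrum ℝ A, ℝ)) := (cfcHom_nonneg_iff (R := ℝ) hA).2 hf
      exact (Complex.le_def.1
        (((ContinuousLinearMap.nonneg_iff_isPositive _).1 h).inner_nonneg_left v)).1)
  obtain ⟨R, hR⟩ := hcomp.isBounded.exists_norm_le
  refine ⟨(RealRMK.rieszMeasure Λ).map Subtype.val, inferInstance, ⟨R, ?_⟩, fun P => ?_⟩
  · rw [MeasureTheory.ae_map_iff (by fun_prop) (measurableSet_le (by fun_prop) (by fun_prop))]
    exact Eventually.of_forall fun x => hR x x.2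
  · rw [MeasureTheory.integral_map (by fun_prop) P.continuous.aestronglyMeasurable]
    have key := RealRMK.integral_rieszMeasure Λ (CompactlySupportedContinuousMap.continuousMapEquiv
      (P.toContinuousMapOn (spectrum ℝ A)))
    refine key.trans ?_
    change (inner ℂ (cfcHom hA (P.toContinuousMapOn (spectrum ℝ A)) v) v).re = _
    congr 3
    have h1 := cfc_apply (fun x => P.eval x) A hA P.continuous.continuousOn
    rw [← cfc_polynomial P A hA, h1]
    rfl

theorem norm_letter_inv_mul {α : Type*} [DecidableEq α] (l : α × Bool) (y : FreeGroup α) :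
    FreeGroup.norm ((FreeGroup.mk [l])⁻¹ * y) =
      if y.toWord.head? = some l then FreeGroup.norm y - 1 else FreeGroup.norm y + 1 := by
  have h : ((FreeGroup.mk [l])⁻¹ * y).toWord = FreeGroup.reduce ((l.1, !l.2) :: y.toWord) := by
    conv_lhs => rw [← FreeGroup.mk_toWord (x := y)]
    rw [FreeGroup.inv_mk, FreeGroup.mul_mk, FreeGroup.toWord_mk]
    simp [FreeGroup.invRev]
  unfold FreeGroup.norm
  rw [h, FreeGroup.reduce.cons, FreeGroup.reduce_toWord]
  obtain ⟨a, b⟩ := l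
  cases hw : y.toWord with
  | nil => simp
  | cons hd tl =>
    obtain ⟨a', b'⟩ := hd
    simp only [List.head?_cons, Option.some.injEq, Prod.mk.injEq, Bool.not_inj_iff]
    by_cases h1 : a = a' ∧ b = b'
    · simp [h1]
    · rw [if_neg h1, if_neg (by tauto)]
      simp

theorem finite_norm_eq (r n : ℕ) : {x : FreeGroup (Fin r) | FreeGroup.norm x = n}.Finite :=
  (List.finite_length_eq (Fin r × Bool) n).preimage FreeGroup.toWord_injective.injOn

/-- The sphere of radius `n` in a free group of finite rank. -/
noncomputable def freeSphere (r n : ℕ) : Finset (FreeGroup (Fin r)) :=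
  (finite_norm_eq r n).toFinset

@[simp]
theorem mem_freeSphere {r n : ℕ} {x : FreeGroup (Fin r)} :
    x ∈ freeSphere r n ↔ FreeGroup.norm x = n := by
  simp [freeSphere]

theorem freeSphere_zero (r : ℕ) : freeSphere r 0 = {1} := by
  ext x
  simp

theorem card_letters_norm_inv_mul_pred (r n : ℕ) (y : FreeGroup (Fin r))
    (hy : FreeGroup.norm y = n + 1) :
    (Finset.univ.filter fun l : Fin r × Bool =>
      FreeGroup.norm ((FreeGroup.mk [l])⁻¹ * y) = n).card = 1 := by
  obtain ⟨hd, tl, hw⟩ := List.exists_cons_of_length_eq_add_one hy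
  rw [Finset.card_eq_one]
  refine ⟨hd, ?_⟩
  ext l
  rw [Finset.mem_filter, norm_letter_inv_mul, hw, hy]
  simp only [List.head?_cons, Option.some.injEq, Finset.mem_univ, true_and, Finset.mem_singleton]
  split_ifs with h
  · simp [h]
  · simp [Ne.symm h]
    omega

theorem card_letters_norm_inv_mul_succ (r n : ℕ) (y : FreeGroup (Fin r))
    (hy : FreeGroup.norm y = n + 1) :
    (Finset.univ.filter fun l : Fin r × Bool =>
      FreeGroup.norm ((FreeGroup.mk [l])⁻¹ * y) = n + 2).card = 2 * r - 1 := by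
  obtain ⟨hd, tl, hw⟩ := List.exists_cons_of_length_eq_add_one hy
  have : (Finset.univ.filter fun l : Fin r × Bool =>
      FreeGroup.norm ((FreeGroup.mk [l])⁻¹ * y) = n + 2) = Finset.univ.erase hd := by
    ext l
    rw [Finset.mem_filter, norm_letter_inv_mul, hw, hy]
    simp only [List.head?_cons, Option.some.injEq, Finset.mem_univ, true_and, Finset.mem_erase,
      and_true]
    split_ifs with h
    · simp [h]
    · simp [Ne.symm h]
  rw [this, Finset.card_erase_of_mem (Finset.mem_univ _)]
  simp [mul_comm]

theorem sum_letters_sum_sphere {M : Type*} [AddCommMonoid M] (r n : ℕ)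
    (f : FreeGroup (Fin r) → M) :
    ∑ l : Fin r × Bool, ∑ x ∈ freeSphere r (n + 1), f (FreeGroup.mk [l] * x) =
      ∑ y ∈ freeSphere r (n + 2), f y +
        (if n = 0 then 2 * r else 2 * r - 1) • ∑ y ∈ freeSphere r n, f y := by
  classical
  have hdisj : Disjoint (freeSphere r (n + 2)) (freeSphere r n) := by
    rw [Finset.disjoint_left]
    intro x hx hx'
    rw [mem_freeSphere] at hx hx'
    omega
  have h1 (l : Fin r × Bool) : ∑ x ∈ freeSphere r (n + 1), f (FreeGroup.mk [l] * x) =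
      ∑ y ∈ freeSphere r (n + 2) ∪ freeSphere r n,
        if FreeGroup.norm ((FreeGroup.mk [l])⁻¹ * y) = n + 1 then f y else 0 := by
    rw [← Finset.sum_filter]
    refine Finset.sum_nbij' (fun x => FreeGroup.mk [l] * x) (fun y => (FreeGroup.mk [l])⁻¹ * y)
      ?_ ?_
      (fun x _ => inv_mul_cancel_left _ x) (fun y _ => mul_inv_cancel_left _ y) (by simp)
    · intro x hx
      rw [mem_freeSphere] at hx
      simp only [Finset.mem_filter, Finset.mem_union, mem_freeSphere, inv_mul_cancel_left, hx,
        and_true]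
      have h2 := norm_letter_inv_mul l (FreeGroup.mk [l] * x)
      rw [inv_mul_cancel_left, hx] at h2
      split_ifs at h2 <;> omega
    · intro y hy
      rw [Finset.mem_filter] at hy
      simpa using hy.2
  simp_rw [h1]
  rw [Finset.sum_comm, Finset.sum_union hdisj, Finset.smul_sum]
  have h2 (y : FreeGroup (Fin r)) : (∑ l : Fin r × Bool,
      if FreeGroup.norm ((FreeGroup.mk [l])⁻¹ * y) = n + 1 then f y else 0) =
      (Finset.univ.filter fun l : Fin r × Bool =>
      FreeGroup.norm ((FreeGroup.mk [l])⁻¹ * y) = n + 1).card • f y := by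
    rw [← Finset.sum_filter, Finset.sum_const]
  simp_rw [h2]
  congr 1
  · refine Finset.sum_congr rfl fun y hy => ?_
    rw [card_letters_norm_inv_mul_pred r (n + 1) y (mem_freeSphere.1 hy), one_smul]
  · refine Finset.sum_congr rfl fun y hy => ?_
    rw [mem_freeSphere] at hy
    rcases n with _ | n
    · rw [FreeGroup.norm_eq_zero] at hy
      subst hy
      simp [norm_letter_inv_mul, mul_comm, -FreeGroup.inv_mk, -mul_one]
    · rw [card_letters_norm_inv_mul_succ r n y hy]
      simp

theorem freeSphere_one_sum {M : Type*} [AddCommMonoid M] (r : ℕ) (f : FreeGroup (Fin r) → M) :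
    ∑ x ∈ freeSphere r 1, f x = ∑ l : Fin r × Bool, f (FreeGroup.mk [l]) := by
  symm
  refine Finset.sum_bij (fun l _ => FreeGroup.mk [l]) ?_ ?_ ?_ (by simp)
  · intro l _
    simp [FreeGroup.norm]
  · intro l _ l' _ h
    simpa using congrArg FreeGroup.toWord h
  · intro x hx
    rw [mem_freeSphere] at hx
    obtain ⟨l, hl⟩ := List.length_eq_one_iff.1 hx
    exact ⟨l, Finset.mem_univ _, by rw [← hl, FreeGroup.mk_toWord]⟩

theorem aeval_spherePoly_sum_letters (r : ℕ) (hr : 1 ≤ r) {B : Type*} [Ring B] [Algebra ℝ B]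
    (π : FreeGroup (Fin r) → B) (hone : π 1 = 1) (hmul : ∀ x y, π (x * y) = π x * π y) (n : ℕ) :
    Polynomial.aeval (∑ l : Fin r × Bool, π (FreeGroup.mk [l])) (spherePoly (2 * r - 1) n) =
      ∑ x ∈ freeSphere r n, π x := by
  set A := ∑ l : Fin r × Bool, π (FreeGroup.mk [l]) with hA
  have hstep (n : ℕ) : A * ∑ x ∈ freeSphere r (n + 1), π x =
      ∑ y ∈ freeSphere r (n + 2), π y +
        (if n = 0 then 2 * r else 2 * r - 1) • ∑ y ∈ freeSphere r n, π y := by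
    rw [← sum_letters_sum_sphere, hA, Finset.sum_mul]
    simp_rw [Finset.mul_sum, hmul]
  induction n using Nat.strong_induction_on with
  | _ n ih =>
    match n with
    | 0 => simp [spherePoly, freeSphere_zero, hone]
    | 1 => simp [spherePoly, freeSphere_one_sum, hA]
    | 2 =>
      have h := hstep 0
      rw [if_pos rfl, ← Nat.cast_smul_eq_nsmul ℝ] at h
      rw [spherePoly_two, map_sub, map_mul, ih 1 (by norm_num), Polynomial.aeval_X, h,
        Polynomial.aeval_C, Algebra.algebraMap_eq_smul_one, freeSphere_zero, Finset.sum_singleton,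
        hone]
      push_cast
      module
    | n + 3 =>
      have h := hstep (n + 1)
      rw [if_neg (by omega), ← Nat.cast_smul_eq_nsmul ℝ] at h
      rw [spherePoly_add_three, map_sub, map_mul, map_mul, ih (n + 1) (by omega),
        ih (n + 2) (by omega), Polynomial.aeval_X, h, Polynomial.aeval_C,
        Algebra.algebraMap_eq_smul_one, Nat.cast_sub (by omega), smul_one_mul]
      push_cast
      module

theorem exists_measure_integral_spherePoly_eq_sum_inner (r : ℕ) (hr : 1 ≤ r) {H : Type*}
    [NormedAddCommGroup H] [InnerProductSpace ℂ H] [CompleteSpace H]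
    (π : FreeGroup (Fin r) → H →L[ℂ] H) (hone : π 1 = 1) (hmul : ∀ x y, π (x * y) = π x * π y)
    (hstar : ∀ x, star (π x) = π x⁻¹) (v : H) :
    ∃ μ : MeasureTheory.Measure ℝ, MeasureTheory.IsFiniteMeasure μ ∧
      (∃ R : ℝ, ∀ᵐ x ∂μ, |x| ≤ R) ∧
      ∀ n, ∫ x, (spherePoly (2 * r - 1) n).eval x ∂μ =
        (∑ x ∈ freeSphere r n, inner ℂ (π x v) v).re := by
  have hA : IsSelfAdjoint (∑ l : Fin r × Bool, π (FreeGroup.mk [l])) := by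
    rw [isSelfAdjoint_iff, star_sum]
    simp_rw [hstar]
    refine Fintype.sum_equiv ((Equiv.refl _).prodCongr Equiv.boolNot) _ _ fun l => ?_
    obtain ⟨i, b⟩ := l
    simp [FreeGroup.invRev]
  obtain ⟨μ, hμ, hR, h⟩ := exists_measure_integral_eval_eq_inner_aeval _ hA v
  refine ⟨μ, hμ, hR, fun n => ?_⟩
  rw [h, aeval_spherePoly_sum_letters r hr π hone hmul, sum_apply, sum_inner]

theorem exists_cogrowth_measure (r : ℕ) (hr : 1 ≤ r) (N : Subgroup (FreeGroup (Fin r))) :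
    ∃ μ : MeasureTheory.Measure ℝ, MeasureTheory.IsFiniteMeasure μ ∧
      (∃ R : ℝ, ∀ᵐ x ∂μ, |x| ≤ R) ∧
      ∀ n, ∫ x, (spherePoly (2 * r - 1) n).eval x ∂μ =
        Nat.card {x : FreeGroup (Fin r) // x ∈ N ∧ FreeGroup.norm x = n} := by
  classical
  let G := FreeGroup (Fin r) ⧸ N
  obtain ⟨μ, hμ, hR, h⟩ := exists_measure_integral_spherePoly_eq_sum_inner r hr (permRep G)
    permRep_one permRep_mul star_permRep (lp.single 2 ((1 : FreeGroup (Fin r)) : G) (1 : ℂ))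
  refine ⟨μ, hμ, hR, fun n => ?_⟩
  rw [h]
  simp_rw [inner_permRep_single]
  have hmem (x : FreeGroup (Fin r)) : x • ((1 : FreeGroup (Fin r)) : G) = (1 : FreeGroup (Fin r)) ↔
      x ∈ N := by
    rw [MulAction.Quotient.smul_coe, QuotientGroup.eq]
    simp
  simp_rw [hmem]
  rw [Finset.sum_boole, Complex.natCast_re, ← Nat.card_eq_finsetCard]
  congr 1
  refine Nat.card_congr (Equiv.subtypeEquivRight fun x => ?_)
  simp [and_comm]

theorem eval_ballPoly_add_two (q x : ℝ) (n : ℕ) :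
    (ballPoly q (n + 2)).eval x = x * (ballPoly q (n + 1)).eval x - q * (ballPoly q n).eval x := by
  simp [ballPoly]

theorem eval_ballPoly_invariant (q x : ℝ) (n : ℕ) :
    (ballPoly q (n + 1)).eval x ^ 2 - x * (ballPoly q n).eval x * (ballPoly q (n + 1)).eval x +
      q * (ballPoly q n).eval x ^ 2 = q ^ (n + 1) := by
  induction n with
  | zero => simp [ballPoly]; ring
  | succ n ih =>
    rw [eval_ballPoly_add_two, pow_succ q (n + 1), ← ih]
    ring

theorem abs_eval_ballPoly_le {s x : ℝ} (hs : 0 ≤ s) (hx : |x| ≤ 2 * s) (n : ℕ) :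
    |(ballPoly (s ^ 2) n).eval x| ≤ (n + 1) * s ^ n := by
  induction n with
  | zero => simp [ballPoly]
  | succ n ih =>
    set u := (ballPoly (s ^ 2) n).eval x
    set w := (ballPoly (s ^ 2) (n + 1)).eval x
    have hinv : w ^ 2 - x * u * w + s ^ 2 * u ^ 2 = (s ^ 2) ^ (n + 1) :=
      eval_ballPoly_invariant (s ^ 2) x n
    have hx2 : x ^ 2 ≤ (2 * s) ^ 2 := sq_le_sq' (by linarith [abs_le.1 hx]) (abs_le.1 hx).2
    have h1 : |w - x / 2 * u| ≤ s ^ (n + 1) := by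
      refine abs_le_of_sq_le_sq ?_ (by positivity)
      rw [← pow_mul, mul_comm (n + 1), pow_mul, ← hinv]
      nlinarith [mul_nonneg (sub_nonneg.2 hx2) (sq_nonneg u)]
    have h2 : |x / 2 * u| ≤ s * ((n + 1) * s ^ n) := by
      rw [abs_mul]
      refine mul_le_mul ?_ ih (abs_nonneg _) hs
      rw [abs_div, abs_two]
      linarith
    calc |w| = |(w - x / 2 * u) + x / 2 * u| := by ring_nf
      _ ≤ |w - x / 2 * u| + |x / 2 * u| := abs_add_le _ _
      _ ≤ s ^ (n + 1) + s * ((n + 1) * s ^ n) := add_le_add h1 h2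
      _ = ((n + 1 : ℕ) + 1) * s ^ (n + 1) := by push_cast; ring

theorem abs_eval_spherePoly_le {s x : ℝ} (hs : 1 ≤ s) (hx : |x| ≤ 2 * s) (n : ℕ) :
    |(spherePoly (s ^ 2) n).eval x| ≤ 2 * (n + 1) * s ^ n := by
  have hs0 : 0 ≤ s := by linarith
  match n with
  | 0 => simp [spherePoly]
  | 1 =>
    simp only [spherePoly, Polynomial.eval_X, Nat.cast_one]
    linarith
  | n + 2 =>
    have h1 := abs_eval_ballPoly_le hs0 hx (n + 2)
    have h2 := abs_eval_ballPoly_le hs0 hx n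
    have h3 : s ^ n ≤ s ^ (n + 2) := pow_le_pow_right₀ hs (by omega)
    have h4 : (n + 1 : ℝ) * s ^ n ≤ (n + 3) * s ^ (n + 2) := by
      refine mul_le_mul (by linarith) h3 (by positivity) (by positivity)
    simp only [spherePoly, Polynomial.eval_sub]
    refine (abs_sub _ _).trans ?_
    push_cast at h1 ⊢
    linarith

theorem eval_ballPoly_succ_of_root (a b : ℝ) (n : ℕ) :
    (ballPoly (a * b) (n + 1)).eval (a + b) =
      a * (ballPoly (a * b) n).eval (a + b) + b ^ (n + 1) := by
  induction n with
  | zero => simp [ballPoly]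
  | succ n ih =>
    rw [eval_ballPoly_add_two, ih]
    have : b * (ballPoly (a * b) (n + 1)).eval (a + b) =
      b * (a * (ballPoly (a * b) n).eval (a + b) + b ^ (n + 1)) := by rw [ih]
    rw [ih] at this
    ring

theorem pow_le_eval_ballPoly {a b : ℝ} (ha : 0 ≤ a) (hb : 0 ≤ b) (n : ℕ) :
    a ^ n ≤ (ballPoly (a * b) n).eval (a + b) := by
  induction n with
  | zero => simp [ballPoly]
  | succ n ih =>
    rw [eval_ballPoly_succ_of_root, pow_succ']
    have := mul_le_mul_of_nonneg_left ih ha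
    have := pow_nonneg hb (n + 1)
    linarith

theorem pow_half_le_eval_spherePoly {a b : ℝ} (ha : 0 ≤ a) (ha2 : 2 ≤ a ^ 2) (hb : 0 ≤ b) (n : ℕ) :
    a ^ n / 2 ≤ (spherePoly (a * b) n).eval (a + b) := by
  match n with
  | 0 => norm_num [spherePoly]
  | 1 =>
    simp only [spherePoly, Polynomial.eval_X]
    linarith
  | n + 2 =>
    have h0 := pow_le_eval_ballPoly ha hb n
    simp only [spherePoly, Polynomial.eval_sub]
    rw [eval_ballPoly_succ_of_root, eval_ballPoly_succ_of_root]
    have hn1 := mul_nonneg ha (pow_nonneg hb (n + 1))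
    have hn2 := pow_nonneg hb (n + 2)
    have h3 := mul_le_mul_of_nonneg_left h0 (by linarith : 0 ≤ a ^ 2 - 1)
    have h4 : 0 ≤ (a ^ 2 - 2) * a ^ n := mul_nonneg (by linarith) (by positivity)
    have h5 : a ^ (n + 2) = a ^ 2 * a ^ n := by ring
    rw [h5]
    nlinarith

theorem eval_neg_ballPoly (q x : ℝ) (n : ℕ) :
    (ballPoly q n).eval (-x) = (-1) ^ n * (ballPoly q n).eval x := by
  induction n using Nat.twoStepInduction with
  | zero => simp [ballPoly]
  | one => simp [ballPoly]
  | more n ih1 ih2 =>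
    rw [eval_ballPoly_add_two, eval_ballPoly_add_two, ih1, ih2]
    ring

theorem eval_abs_spherePoly_even (q x : ℝ) (n : ℕ) :
    (spherePoly q (2 * n)).eval |x| = (spherePoly q (2 * n)).eval x := by
  rcases abs_choice x with h | h
  · rw [h]
  · rw [h]
    rcases n with _ | n
    · simp [spherePoly]
    · rw [show 2 * (n + 1) = 2 * n + 2 by ring]
      simp only [spherePoly, Polynomial.eval_sub]
      rw [eval_neg_ballPoly, eval_neg_ballPoly]
      simp [pow_add]

theorem pow_half_le_eval_spherePoly_even {s t x : ℝ} (hs : 2 ≤ s ^ 2) (hs0 : 0 ≤ s) (ht : s ≤ t)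
    (hx : t + s ^ 2 / t ≤ |x|) (n : ℕ) :
    t ^ (2 * n) / 2 ≤ (spherePoly (s ^ 2) (2 * n)).eval x := by
  have hspos : 0 < s := by
    rcases hs0.eq_or_lt with h | h
    · rw [← h] at hs
      norm_num at hs
    · exact h
  have htpos : 0 < t := by linarith
  have hx' : t ^ 2 + s ^ 2 ≤ t * |x| := by
    have := mul_le_mul_of_nonneg_left hx htpos.le
    rwa [mul_add, mul_div_cancel₀ _ htpos.ne', ← sq] at this
  have hxs : 2 * s ≤ |x| := by
    by_contra! h
    nlinarith [mul_lt_mul_of_pos_left h htpos, sq_nonneg (t - s)]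
  have hd : 0 ≤ |x| ^ 2 - 4 * s ^ 2 := by nlinarith
  set d := √(|x| ^ 2 - 4 * s ^ 2) with hdd
  have hd2 : d ^ 2 = |x| ^ 2 - 4 * s ^ 2 := Real.sq_sqrt hd
  have h1 : 2 * t - |x| ≤ d := by
    refine (le_abs_self _).trans (Real.abs_le_sqrt ?_)
    nlinarith
  have h2 : d ≤ |x| := by
    refine Real.sqrt_le_iff.2 ⟨abs_nonneg _, ?_⟩
    nlinarith
  have hta : t ≤ (|x| + d) / 2 := by linarith
  have key := pow_half_le_eval_spherePoly (a := (|x| + d) / 2) (b := (|x| - d) / 2)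
    (by linarith) (by nlinarith) (by linarith) (2 * n)
  rw [show (|x| + d) / 2 * ((|x| - d) / 2) = s ^ 2 by nlinarith,
    show (|x| + d) / 2 + (|x| - d) / 2 = |x| by ring, eval_abs_spherePoly_even] at key
  refine le_trans ?_ key
  gcongr

theorem abs_eval_ballPoly_le_pow {q R x : ℝ} (hq : 0 ≤ q) (hx : |x| ≤ R) (n : ℕ) :
    |(ballPoly q n).eval x| ≤ (R + q + 1) ^ n := by
  have hR : 0 ≤ R := (abs_nonneg x).trans hx
  induction n using Nat.twoStepInduction with
  | zero => simp [ballPoly]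
  | one =>
    simp only [ballPoly, Polynomial.eval_X, pow_one]
    linarith
  | more n ih1 ih2 =>
    rw [eval_ballPoly_add_two]
    refine (abs_sub _ _).trans ?_
    rw [abs_mul, abs_mul, abs_of_nonneg hq]
    have h1 := mul_le_mul hx ih2 (abs_nonneg _) hR
    have h2 := mul_le_mul_of_nonneg_left ih1 hq
    have h3 : 0 ≤ (R + q + 1) ^ n := by positivity
    have h4 : (R + q + 1) ^ (n + 2) = R * (R + q + 1) ^ (n + 1) + q * (R + q + 1) ^ n +
      ((q + 1) * (R + q) + 1) * (R + q + 1) ^ n := by ring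
    have h5 : 0 ≤ ((q + 1) * (R + q) + 1) * (R + q + 1) ^ n := by positivity
    linarith

theorem abs_eval_spherePoly_le_pow {q R x : ℝ} (hq : 0 ≤ q) (hx : |x| ≤ R) (n : ℕ) :
    |(spherePoly q n).eval x| ≤ 2 * (R + q + 1) ^ n := by
  have hR : 0 ≤ R := (abs_nonneg x).trans hx
  match n with
  | 0 => simp [spherePoly]
  | 1 =>
    simp only [spherePoly, Polynomial.eval_X, pow_one]
    linarith
  | n + 2 =>
    have h1 := abs_eval_ballPoly_le_pow hq hx (n + 2)
    have h2 := abs_eval_ballPoly_le_pow hq hx n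
    have h3 : (R + q + 1) ^ n ≤ (R + q + 1) ^ (n + 2) :=
      pow_le_pow_right₀ (by linarith) (by omega)
    simp only [spherePoly, Polynomial.eval_sub]
    refine (abs_sub _ _).trans ?_
    linarith

theorem hasSum_spherePoly {q R x : ℝ} (hq : 0 ≤ q) (hx : |x| ≤ R) {z : ℂ}
    (hz : (R + q + 1) * ‖z‖ < 1) :
    HasSum (fun n => (((spherePoly q n).eval x : ℝ) : ℂ) * z ^ n)
      ((1 - z ^ 2) * (1 - x * z + q * z ^ 2)⁻¹) := by
  have hR : 0 ≤ R := (abs_nonneg x).trans hx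
  set f : ℕ → ℂ := fun n => (((ballPoly q n).eval x : ℝ) : ℂ) * z ^ n with hf
  have hsum : Summable f := by
    refine Summable.of_norm_bounded (summable_geometric_of_lt_one (by positivity) hz) fun n => ?_
    rw [hf, norm_mul, norm_pow, Complex.norm_real, mul_pow]
    exact mul_le_mul_of_nonneg_right (abs_eval_ballPoly_le_pow hq hx n) (by positivity)
  obtain ⟨T, hT⟩ := hsum
  have hf0 : f 0 = 1 := by simp [hf, ballPoly]
  have hf1 : f 1 = x * z := by simp [hf, ballPoly]
  have h1 : HasSum (fun n => f (n + 1)) (T - 1) := by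
    have := (hasSum_nat_add_iff' 1).2 hT
    simpa [hf0] using this
  have h2 : HasSum (fun n => f (n + 2)) (T - (1 + x * z)) := by
    have := (hasSum_nat_add_iff' 2).2 hT
    simpa [Finset.sum_range_succ, hf0, hf1] using this
  have h3 : HasSum (fun n => f (n + 2)) (x * z * (T - 1) - q * z ^ 2 * T) := by
    refine ((h1.mul_left (x * z : ℂ)).sub (hT.mul_left (q * z ^ 2 : ℂ))).congr_fun ?_
    intro n
    simp only [hf, eval_ballPoly_add_two]
    push_cast
    ring
  have hT1 : (1 - x * z + q * z ^ 2) * T = 1 := by linear_combination h2.unique h3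
  have hT2 : T = (1 - x * z + q * z ^ 2)⁻¹ := eq_inv_of_mul_eq_one_right hT1
  have h4 : HasSum (fun n => (((spherePoly q (n + 2)).eval x : ℝ) : ℂ) * z ^ (n + 2))
      (T - (1 + x * z) - z ^ 2 * T) := by
    refine (h2.sub (hT.mul_left (z ^ 2 : ℂ))).congr_fun ?_
    intro n
    simp only [hf, spherePoly, Polynomial.eval_sub]
    push_cast
    ring
  have h5 := (hasSum_nat_add_iff (f := fun n => (((spherePoly q n).eval x : ℝ) : ℂ) * z ^ n) 2).1 h4
  rw [← hT2]
  have h6 : T - (1 + x * z) - z ^ 2 * T + ∑ n ∈ Finset.range 2,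
      (((spherePoly q n).eval x : ℝ) : ℂ) * z ^ n = (1 - z ^ 2) * T := by
    simp [Finset.sum_range_succ, spherePoly]
    ring
  rwa [h6] at h5

open MeasureTheory in
theorem integrable_eval_of_ae_abs_le {μ : Measure ℝ} [IsFiniteMeasure μ] {R : ℝ}
    (hR : ∀ᵐ x ∂μ, |x| ≤ R) (P : Polynomial ℝ) : Integrable (fun x => P.eval x) μ := by
  obtain ⟨C, hC⟩ := (isCompact_Icc (a := -R) (b := R)).exists_bound_of_continuousOn
    P.continuous.continuousOn
  refine Integrable.of_bound P.continuous.aestronglyMeasurable C ?_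
  filter_upwards [hR] with x hx
  exact hC x (abs_le.1 hx)

open MeasureTheory in
theorem measure_abs_ge_eq_zero {μ : Measure ℝ} [IsFiniteMeasure μ] {R s c t : ℝ}
    (hR : ∀ᵐ x ∂μ, |x| ≤ R) (hs0 : 0 ≤ s) (hs : 2 ≤ s ^ 2) (g : ℕ → ℝ) (hg0 : ∀ n, 0 ≤ g n)
    (hg : ∀ n, ∫ x, (spherePoly (s ^ 2) (2 * n)).eval x ∂μ = g n)
    (hc : Tendsto (fun n : ℕ => g n ^ ((1 : ℝ) / (2 * n))) atTop (nhds c))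
    (hst : s < t) (hct : c < t) : μ {x | t + s ^ 2 / t ≤ |x|} = 0 := by
  have hs1 : 1 ≤ s := by nlinarith
  have ht0 : 0 < t := by linarith
  set E := {x : ℝ | t + s ^ 2 / t ≤ |x|} with hE
  have hEm : MeasurableSet E := measurableSet_le (by fun_prop) (by fun_prop)
  have key (n : ℕ) : μ.real E * (t ^ (2 * n) / 2) ≤
      g n + 2 * (2 * n + 1) * s ^ (2 * n) * μ.real Set.univ := by
    have hint := integrable_eval_of_ae_abs_le hR (spherePoly (s ^ 2) (2 * n))
    have hle : ∀ x, E.indicator (fun _ => t ^ (2 * n) / 2) x ≤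
        (spherePoly (s ^ 2) (2 * n)).eval x + 2 * (2 * n + 1) * s ^ (2 * n) := by
      intro x
      have hnn : 0 ≤ 2 * (2 * (n : ℝ) + 1) * s ^ (2 * n) := by positivity
      by_cases hx : x ∈ E
      · rw [Set.indicator_of_mem hx]
        have := pow_half_le_eval_spherePoly_even hs hs0 hst.le hx n
        linarith
      · rw [Set.indicator_of_notMem hx]
        rcases le_total |x| (2 * s) with h | h
        · have := (abs_le.1 (abs_eval_spherePoly_le hs1 h (2 * n))).1
          push_cast at this
          linarith
        · have := pow_half_le_eval_spherePoly_even hs hs0 le_rfl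
            (by rw [sq, mul_div_assoc, div_self (by linarith)]; linarith) n (x := x)
          have h2 : 0 ≤ s ^ (2 * n) / 2 := by positivity
          linarith
    have := integral_mono ((integrable_const _).indicator hEm) (hint.add (integrable_const _)) hle
    rw [integral_indicator hEm, setIntegral_const, integral_add' hint (integrable_const _), hg,
      integral_const] at this
    simp only [smul_eq_mul] at this
    linarith
  obtain ⟨w, hw1, hw2⟩ := exists_between (max_lt hst hct)
  have hsw : s < w := (le_max_left _ _).trans_lt hw1
  have hcw : c < w := (le_max_right _ _).trans_lt hw1
  have hw0 : 0 < w := by linarith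
  have hlim1 : Tendsto (fun n : ℕ => (w / t) ^ (2 * n)) atTop (nhds 0) :=
    (tendsto_pow_atTop_nhds_zero_of_lt_one (by positivity) ((div_lt_one ht0).2 hw2)).comp
      (tendsto_id.const_mul_atTop' (by norm_num))
  have hlim2 : Tendsto (fun n : ℕ => (2 * n + 1 : ℝ) * (s / t) ^ (2 * n)) atTop (nhds 0) := by
    have h1 := tendsto_self_mul_const_pow_of_lt_one (r := s / t) (by positivity)
      ((div_lt_one ht0).2 hst)
    have h2 := tendsto_pow_atTop_nhds_zero_of_lt_one (r := s / t) (by positivity)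
      ((div_lt_one ht0).2 hst)
    have h3 := (h1.add h2).comp (tendsto_id.const_mul_atTop' (r := 2) (by norm_num))
    simp only [add_zero] at h3
    refine h3.congr fun n => ?_
    simp only [Function.comp, id]
    push_cast
    ring
  have hgw : ∀ᶠ n in atTop, g n ≤ w ^ (2 * n) := by
    filter_upwards [hc.eventually (gt_mem_nhds hcw), eventually_gt_atTop 0] with n hn hn0
    have hn0' : (0 : ℝ) < 2 * n := by positivity
    have h1 := Real.rpow_le_rpow (Real.rpow_nonneg (hg0 n) _) hn.le hn0'.le
    rw [← Real.rpow_mul (hg0 n), one_div_mul_cancel hn0'.ne', Real.rpow_one] at h1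
    refine h1.trans_eq ?_
    rw [← Real.rpow_natCast]
    push_cast
    rfl
  have hfin : ∀ᶠ n : ℕ in atTop, μ.real E / 2 ≤
      (w / t) ^ (2 * n) + 2 * ((2 * n + 1) * (s / t) ^ (2 * n)) * μ.real Set.univ := by
    filter_upwards [hgw] with n hn
    have h1 := key n
    have htn : 0 < t ^ (2 * n) := by positivity
    rw [div_pow, div_pow]
    have h2 : μ.real E / 2 ≤
        (w ^ (2 * n) + 2 * (2 * n + 1) * s ^ (2 * n) * μ.real Set.univ) / t ^ (2 * n) := by
      rw [le_div_iff₀ htn]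
      linarith
    refine h2.trans_eq ?_
    ring
  have hle := ge_of_tendsto (hlim1.add ((hlim2.const_mul 2).mul_const (μ.real Set.univ))) hfin
  have hE0 : μ.real E / 2 ≤ 0 := by simpa using hle
  have h0 : μ.real E = 0 := le_antisymm (by linarith) measureReal_nonneg
  rwa [measureReal_eq_zero_iff] at h0

open MeasureTheory in
theorem ae_abs_le_of_tendsto {μ : Measure ℝ} [IsFiniteMeasure μ] {R s c m : ℝ}
    (hR : ∀ᵐ x ∂μ, |x| ≤ R) (hs0 : 0 ≤ s) (hs : 2 ≤ s ^ 2) (g : ℕ → ℝ) (hg0 : ∀ n, 0 ≤ g n)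
    (hg : ∀ n, ∫ x, (spherePoly (s ^ 2) (2 * n)).eval x ∂μ = g n)
    (hc : Tendsto (fun n : ℕ => g n ^ ((1 : ℝ) / (2 * n))) atTop (nhds c))
    (hsm : s ≤ m) (hcm : c ≤ m) : ∀ᵐ x ∂μ, |x| ≤ m + s ^ 2 / m := by
  have hs1 : 1 ≤ s := by nlinarith
  have hm0 : 0 < m := by linarith
  have h (k : ℕ) : ∀ᵐ x ∂μ, |x| < (m + 1 / (k + 1)) + s ^ 2 / (m + 1 / (k + 1)) := by
    have hk : (0 : ℝ) < 1 / (k + 1) := by positivity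
    have := measure_abs_ge_eq_zero hR hs0 hs g hg0 hg hc (t := m + 1 / (k + 1)) (by linarith)
      (by linarith)
    rw [ae_iff]
    simpa only [not_lt] using this
  filter_upwards [ae_all_iff.2 h] with x hx
  have h1 : Tendsto (fun k : ℕ => m + 1 / ((k : ℝ) + 1)) atTop (nhds m) := by
    simpa using (tendsto_one_div_add_atTop_nhds_zero_nat (𝕜 := ℝ)).const_add m
  exact ge_of_tendsto (h1.add (tendsto_const_nhds.div h1 hm0.ne')) (Eventually.of_forall fun k => (hx k).le)

open MeasureTheory in
theorem differentiableAt_integral_inv {μ : Measure ℝ} [IsFiniteMeasure μ] {K : Set ℝ}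
    (hK : IsCompact K) (hμ : ∀ᵐ x ∂μ, x ∈ K) (q : ℝ) {U : Set ℂ} (hU : IsOpen U)
    (hne : ∀ z ∈ U, ∀ x ∈ K, (1 - x * z + q * z ^ 2 : ℂ) ≠ 0) {z₀ : ℂ} (hz₀ : z₀ ∈ U) :
    DifferentiableAt ℂ (fun z => ∫ x, (1 - (x : ℂ) * z + q * z ^ 2)⁻¹ ∂μ) z₀ := by
  obtain ⟨ε, hε, hball⟩ := Metric.nhds_basis_closedBall.mem_iff.1 (hU.mem_nhds hz₀)
  have hcont : ContinuousOn
      (fun p : ℂ × ℝ => -(-(p.2 : ℂ) + q * (2 * p.1)) / (1 - p.2 * p.1 + q * p.1 ^ 2) ^ 2)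
      (Metric.closedBall z₀ ε ×ˢ K) := by
    refine ContinuousOn.div (by fun_prop) (by fun_prop) fun p hp => ?_
    exact pow_ne_zero 2 (hne p.1 (hball hp.1) p.2 hp.2)
  have hcont' : ContinuousOn (fun x : ℝ => (1 - (x : ℂ) * z₀ + q * z₀ ^ 2)⁻¹) K :=
    ContinuousOn.inv₀ (by fun_prop) fun x hx => hne z₀ hz₀ x hx
  obtain ⟨C, hC⟩ := ((isCompact_closedBall z₀ ε).prod hK).exists_bound_of_continuousOn hcont
  obtain ⟨C', hC'⟩ := hK.exists_bound_of_continuousOn hcont'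
  refine (hasDerivAt_integral_of_dominated_loc_of_deriv_le (𝕜 := ℂ)
    (F := fun z (x : ℝ) => (1 - (x : ℂ) * z + q * z ^ 2)⁻¹)
    (F' := fun z (x : ℝ) => -(-(x : ℂ) + q * (2 * z)) / (1 - x * z + q * z ^ 2) ^ 2)
    (bound := fun _ => C) (Metric.closedBall_mem_nhds z₀ hε)
    (Eventually.of_forall fun z => Measurable.aestronglyMeasurable (by fun_prop)) ?_
    (Measurable.aestronglyMeasurable (by fun_prop)) ?_
    (integrable_const _) ?_).2.differentiableAt
  · refine Integrable.of_bound (Measurable.aestronglyMeasurable (by fun_prop)) C' ?_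
    filter_upwards [hμ] with x hx using hC' x hx
  · filter_upwards [hμ] with x hx z hz using hC (z, x) ⟨hz, hx⟩
  · filter_upwards [hμ] with x hx z hz
    refine HasDerivAt.fun_inv ?_ (hne z (hball hz) x hx)
    have h1 := ((hasDerivAt_id z).const_mul (x : ℂ)).const_sub 1
    have h2 := ((hasDerivAt_id z).pow 2).const_mul (q : ℂ)
    refine (h1.add h2).congr_deriv ?_
    simp

theorem re_im_of_quadratic_eq_zero {q x : ℝ} (hq : 0 < q) {z : ℂ}
    (h : (1 - x * z + q * z ^ 2 : ℂ) = 0) :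
    (z.im = 0 ∧ 1 - x * z.re + q * z.re ^ 2 = 0) ∨
      (x ^ 2 < 4 * q ∧ q * (z.re ^ 2 + z.im ^ 2) = 1) := by
  have hre := congrArg Complex.re h
  have him := congrArg Complex.im h
  simp [sq] at hre him
  by_cases hz : z.im = 0
  · left
    rw [hz] at hre
    exact ⟨hz, by linarith⟩
  · right
    have hx : x = 2 * q * z.re := by
      have : z.im * (2 * q * z.re - x) = 0 := by linarith
      rcases mul_eq_zero.1 this with h | h
      · exact absurd h hz
      · linarith
    have h1 : q * (z.re ^ 2 + z.im ^ 2) = 1 := by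
      rw [hx] at hre
      linarith
    refine ⟨?_, h1⟩
    have : 0 < q ^ 2 * z.im ^ 2 := by positivity
    rw [hx]
    nlinarith

theorem quadratic_ne_zero_of_norm_lt {s x : ℝ} (hs : 0 < s) (hx : |x| ≤ 2 * s) {z : ℂ}
    (hz : ‖z‖ < s⁻¹) : (1 - x * z + (s ^ 2 : ℝ) * z ^ 2 : ℂ) ≠ 0 := by
  intro h
  have hz2 : s ^ 2 * (z.re ^ 2 + z.im ^ 2) < 1 := by
    have h1 : s * ‖z‖ < 1 := by
      have := mul_lt_mul_of_pos_left hz hs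
      rwa [mul_inv_cancel₀ hs.ne'] at this
    have h2 : (s * ‖z‖) ^ 2 < 1 := by
      have : 0 ≤ s * ‖z‖ := by positivity
      nlinarith
    rwa [mul_pow, Complex.sq_norm, Complex.normSq_apply, ← sq, ← sq] at h2
  rcases re_im_of_quadratic_eq_zero (by positivity) h with ⟨him, h1⟩ | ⟨-, h1⟩
  · rw [him] at hz2
    have hx2 : x ^ 2 ≤ (2 * s) ^ 2 := sq_le_sq' (by linarith [abs_le.1 hx]) (abs_le.1 hx).2
    have h3 : x * z.re = 1 + s ^ 2 * z.re ^ 2 := by linarith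
    have h4 : (x * z.re) ^ 2 ≤ (2 * s) ^ 2 * z.re ^ 2 := by
      rw [mul_pow]
      exact mul_le_mul_of_nonneg_right hx2 (sq_nonneg _)
    rw [h3] at h4
    nlinarith
  · linarith

theorem quadratic_ne_zero_of_notMem {q c x : ℝ} (hq : 0 < q) (hc : 0 < c) (hqc : q ≤ c ^ 2) (hx : 4 * q ≤ x ^ 2)
    (hx' : |x| ≤ c + q / c) {z : ℂ}
    (hz : z ∉ Complex.ofReal ''
      (Set.Icc (-(c / q)) (-(1 / c)) ∪ Set.Icc (1 / c) (c / q))) :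
    (1 - x * z + q * z ^ 2 : ℂ) ≠ 0 := by
  intro h
  rcases re_im_of_quadratic_eq_zero hq h with ⟨him, h1⟩ | ⟨h1, -⟩
  · refine hz ⟨z.re, ?_, Complex.ext (by simp) (by simp [him])⟩
    have key : ∀ t y : ℝ, 0 < t → y ≤ c + q / c → 1 - y * t + q * t ^ 2 = 0 →
        t ∈ Set.Icc (1 / c) (c / q) := by
      intro t y ht hy h
      have h2 : (c * t - 1) * (q * t - c) ≤ 0 := by
        have h3 : y * c ≤ c ^ 2 + q := by
          have := mul_le_mul_of_nonneg_right hy hc.le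
          rwa [add_mul, div_mul_cancel₀ _ hc.ne', ← sq] at this
        have h4 := mul_le_mul_of_nonneg_left h3 ht.le
        have h5 : c * (1 - y * t + q * t ^ 2) = 0 := by rw [h, mul_zero]
        linarith
      have h6 : 1 ≤ t * c := by
        by_contra! h7
        have h8 : c ≤ q * t := by nlinarith
        nlinarith
      have h7 : t * q ≤ c := by
        by_contra! h7
        have h8 : t * c ≤ 1 := by
          by_contra! h8
          nlinarith [mul_pos (sub_pos.2 h7) (sub_pos.2 h8)]
        nlinarith [mul_lt_mul_of_pos_right h7 hc, mul_le_mul_of_nonneg_left h8 hq.le]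
      exact ⟨(div_le_iff₀ hc).2 h6, (le_div_iff₀ hq).2 h7⟩
    rcases lt_trichotomy z.re 0 with h0 | h0 | h0
    · left
      have := key (-z.re) (-x) (by linarith) (by linarith [abs_le.1 hx']) (by linarith)
      exact ⟨by linarith [this.2], by linarith [this.1]⟩
    · rw [h0] at h1
      norm_num at h1
    · right
      exact key z.re x h0 (by linarith [abs_le.1 hx']) h1
  · linarith

theorem inversion_symmetry {q x z : ℂ} (hq : q ≠ 0) (hz : z ≠ 0) :
    z * (1 - x * z + q * z ^ 2)⁻¹ =
      1 / (q * z) * (1 - x * (1 / (q * z)) + q * (1 / (q * z)) ^ 2)⁻¹ := by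
  have h : 1 - x * (1 / (q * z)) + q * (1 / (q * z)) ^ 2 =
      (1 - x * z + q * z ^ 2) / (q * z ^ 2) := by
    field_simp
    ring
  rw [h, inv_div]
  field_simp

/-- Let `r ≥ 2`, `q = 2r - 1`, `N` a nontrivial normal subgroup of the
free group on `r` generators, `γ n` its cogrowth coefficients and `c` its cogrowth
exponent. Then the generating function `∑ γ n z^n` decomposes near `0` as `γ0 + γ1`,
where `γ0` is holomorphic on the open disc of radius `q^(-1/2)` and `γ1` is holomorphic
on `ℂ` minus the two real intervals `[-c/q, -1/c]` and `[1/c, c/q]`; moreover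
`Φ(z) = z·γ1(z)/(1 - z²)` satisfies `Φ(z) = Φ(1/(qz))` on this domain. -/
theorem cogrowth_generating_function_decomposition
    (r : ℕ) (hr : 2 ≤ r)
    (N : Subgroup (FreeGroup (Fin r))) (hNnormal : N.Normal) (hNbot : N ≠ ⊥)
    (γ : ℕ → ℕ)
    (hγ : ∀ n, γ n = Nat.card {x : FreeGroup (Fin r) // x ∈ N ∧ FreeGroup.norm x = n})
    (c : ℝ)
    (hc : Tendsto (fun n : ℕ => ((γ (2 * n) : ℝ)) ^ ((1 : ℝ) / (2 * n))) atTop (nhds c))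
    (q : ℝ) (hq : q = 2 * r - 1)
    (D : Set ℂ)
    (hD : D = (Complex.ofReal ''
      (Set.Icc (-(c / q)) (-(1 / c)) ∪ Set.Icc (1 / c) (c / q)))ᶜ) :
    ∃ γ0 γ1 : ℂ → ℂ,
      DifferentiableOn ℂ γ0 {z : ℂ | ‖z‖ < q ^ (-(1 : ℝ) / 2)} ∧
      DifferentiableOn ℂ γ1 D ∧
      (∃ ε > 0, ∀ z : ℂ, ‖z‖ < ε →
        HasSum (fun n : ℕ => (γ n : ℂ) * z ^ n) (γ0 z + γ1 z)) ∧
      (∀ z : ℂ, z ∈ D → z ≠ 0 → z ≠ 1 → z ≠ -1 →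
        1 / ((q : ℂ) * z) ≠ 1 → 1 / ((q : ℂ) * z) ≠ -1 →
        z * γ1 z / (1 - z ^ 2) =
          (1 / ((q : ℂ) * z)) * γ1 (1 / ((q : ℂ) * z)) / (1 - (1 / ((q : ℂ) * z)) ^ 2)) := by
  obtain ⟨μ, hμ, ⟨R, hR⟩, hmom⟩ := exists_cogrowth_measure r (by omega) N
  have hr' : (2 : ℝ) ≤ r := by exact_mod_cast hr
  have hq3 : 3 ≤ q := by linarith
  set s := √q with hs
  have hsq : s ^ 2 = q := Real.sq_sqrt (by linarith)
  have hs1 : 1 ≤ s := Real.one_le_sqrt.2 (by linarith)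
  have hs0 : 0 < s := by linarith
  have hmom' (n : ℕ) : ∫ x, (spherePoly q n).eval x ∂μ = γ n := by
    rw [hq, hmom, hγ]
  have hbound {m : ℝ} (hsm : s ≤ m) (hcm : c ≤ m) : ∀ᵐ x ∂μ, |x| ≤ m + q / m := by
    have := ae_abs_le_of_tendsto hR hs0.le (by linarith) (fun n => (γ (2 * n) : ℝ))
      (fun n => Nat.cast_nonneg _) (fun n => by rw [hsq]; exact hmom' _) hc hsm hcm
    rwa [hsq] at this
  set S : Set ℝ := {x | |x| ≤ 2 * s} with hS
  have hSm : MeasurableSet S := measurableSet_le (by fun_prop) (by fun_prop)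
  set F : MeasureTheory.Measure ℝ → ℂ → ℂ := fun ν z => ∫ x, (1 - (x : ℂ) * z + q * z ^ 2)⁻¹ ∂ν
    with hF
  refine ⟨fun z => (1 - z ^ 2) * F (μ.restrict S) z, fun z => (1 - z ^ 2) * F (μ.restrict Sᶜ) z,
    ?_, ?_, ?_, ?_⟩
  · have hqs : q ^ (-(1 : ℝ) / 2) = s⁻¹ := by
      rw [neg_div, Real.rpow_neg (by linarith), ← Real.sqrt_eq_rpow]
    rw [hqs]
    refine DifferentiableOn.mul (by fun_prop) fun z hz => ?_
    refine (differentiableAt_integral_inv (K := Set.Icc (-(2 * s)) (2 * s)) isCompact_Icc ?_ q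
      (U := {z : ℂ | ‖z‖ < s⁻¹}) (isOpen_lt (by fun_prop) (by fun_prop)) ?_
      hz).differentiableWithinAt
    · filter_upwards [MeasureTheory.ae_restrict_mem hSm] with x hx using abs_le.1 hx
    · intro z hz x hx
      rw [← hsq]
      exact quadratic_ne_zero_of_norm_lt hs0 (abs_le.2 hx) hz
  · rcases le_or_gt c s with hcs | hcs
    · have h0 : μ.restrict Sᶜ = 0 := by
        rw [MeasureTheory.Measure.restrict_eq_zero]
        have := hbound le_rfl hcs
        rw [← hsq, sq, mul_div_assoc, div_self hs0.ne', mul_one, ← two_mul] at this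
        exact this
      simp only [hF, h0, MeasureTheory.integral_zero_measure, mul_zero]
      fun_prop
    · refine DifferentiableOn.mul (by fun_prop) fun z hz => ?_
      have hqc : q ≤ c ^ 2 := by nlinarith
      refine (differentiableAt_integral_inv
        (K := Set.Icc (-(c + q / c)) (c + q / c) ∩ {x | 4 * q ≤ x ^ 2})
        (isCompact_Icc.inter_right (isClosed_le (by fun_prop) (by fun_prop))) ?_ q
        (U := D) ?_ ?_ hz).differentiableWithinAt
      · filter_upwards [MeasureTheory.ae_restrict_mem hSm.compl,
          MeasureTheory.ae_restrict_of_ae (hbound hcs.le le_rfl)] with x hx hx'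
        refine ⟨abs_le.1 hx', ?_⟩
        have h1 : 2 * s < |x| := not_le.1 hx
        have h2 := sq_abs x
        change 4 * q ≤ x ^ 2
        nlinarith
      · rw [hD]
        exact ((isCompact_Icc.union isCompact_Icc).image
          Complex.continuous_ofReal).isClosed.isOpen_compl
      · intro z hz x hx
        rw [hD] at hz
        exact quadratic_ne_zero_of_notMem (by linarith) (by linarith) hqc hx.2 (abs_le.2 hx.1) hz
  · have hR0 : 0 ≤ max R 0 := le_max_right _ _
    have hR' : ∀ᵐ x ∂μ, |x| ≤ max R 0 := by
      filter_upwards [hR] with x hx using hx.trans (le_max_left _ _)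
    set B := max R 0 + q + 1 with hB
    have hB0 : 0 < B := by linarith
    refine ⟨B⁻¹, by positivity, fun z hz => ?_⟩
    have hBz : B * ‖z‖ < 1 := by
      have := mul_lt_mul_of_pos_left hz hB0
      rwa [mul_inv_cancel₀ hB0.ne'] at this
    have hsummable : Summable fun n => 2 * (B * ‖z‖) ^ n :=
      (summable_geometric_of_lt_one (by positivity) hBz).mul_left 2
    have hterm (n : ℕ) (x : ℝ) (hx : |x| ≤ max R 0) :
        ‖(((spherePoly q n).eval x : ℝ) : ℂ) * z ^ n‖ ≤ 2 * (B * ‖z‖) ^ n := by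
      rw [norm_mul, norm_pow, Complex.norm_real, mul_pow, ← mul_assoc]
      exact mul_le_mul_of_nonneg_right (abs_eval_spherePoly_le_pow (by linarith) hx n)
        (by positivity)
    have hmeas (n : ℕ) : Continuous fun x : ℝ => (((spherePoly q n).eval x : ℝ) : ℂ) * z ^ n := by
      have := (spherePoly q n).continuous
      fun_prop
    have hlim : ∀ᵐ x ∂μ, HasSum (fun n => (((spherePoly q n).eval x : ℝ) : ℂ) * z ^ n)
        ((1 - z ^ 2) * (1 - x * z + q * z ^ 2)⁻¹) := by
      filter_upwards [hR'] with x hx using hasSum_spherePoly (by linarith) hx hBz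
    have hint : MeasureTheory.Integrable
        (fun x : ℝ => (1 - z ^ 2) * (1 - x * z + q * z ^ 2)⁻¹) μ := by
      refine MeasureTheory.Integrable.of_bound (Measurable.aestronglyMeasurable (by fun_prop))
        (∑' n, 2 * (B * ‖z‖) ^ n) ?_
      filter_upwards [hlim, hR'] with x hx hx'
      rw [← hx.tsum_eq]
      exact tsum_of_norm_bounded hsummable.hasSum fun n => hterm n x hx'
    have key := MeasureTheory.hasSum_integral_of_dominated_convergence
      (fun n (_ : ℝ) => 2 * (B * ‖z‖) ^ n) (fun n => (hmeas n).aestronglyMeasurable)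
      (fun n => by filter_upwards [hR'] with x hx using hterm n x hx)
      (Eventually.of_forall fun _ => hsummable) (MeasureTheory.integrable_const _) hlim
    rw [← MeasureTheory.integral_add_compl hSm hint, MeasureTheory.integral_const_mul,
      MeasureTheory.integral_const_mul] at key
    refine key.congr_fun fun n => ?_
    rw [MeasureTheory.integral_mul_const, integral_complex_ofReal, hmom']
    simp
  · intro z _ hz hz1 hz2 hw1 hw2
    have hqc : (q : ℂ) ≠ 0 := by
      exact_mod_cast (by linarith : q ≠ 0)
    have hcancel {y : ℂ} (h1 : y ≠ 1) (h2 : y ≠ -1) (a : ℂ) :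
        y * ((1 - y ^ 2) * a) / (1 - y ^ 2) = y * a := by
      have : 1 - y ^ 2 ≠ 0 := by
        intro h
        rcases mul_eq_zero.1 (show (y - 1) * (y + 1) = 0 by linear_combination -h) with h | h
        · exact h1 (sub_eq_zero.1 h)
        · exact h2 (eq_neg_of_add_eq_zero_left h)
      field_simp
    rw [hcancel hz1 hz2, hcancel hw1 hw2]
    simp only [hF]
    rw [← MeasureTheory.integral_const_mul, ← MeasureTheory.integral_const_mul]
    refine MeasureTheory.integral_congr_ae (Eventually.of_forall fun x => ?_)
    exact inversion_symmetry hqc hz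
end

section
/- Let 1 < ρ₀ ≤ ρ be real numbers and let q > 0. Then sup_{x ∈ [ρ₀, ρ]} | U_{2n}(x) − q^{-1} U_{2n−2}(x) − (x + √(x² − 1))^{2n−1} · ((x + √(x² − 1))² − q^{-1}) / (2√(x² − 1)) | → 0 as n → ∞. -/
/-- If `w * v = 1` and `w + v = 2 * x`, then `U n x * (w - v) = w ^ (n + 1) - v ^ (n + 1)`. -/
theorem chebyshevU_eval_mul_sub {R : Type*} [CommRing R] {x w v : R} (hmul : w * v = 1)
    (hadd : w + v = 2 * x) (n : ℕ) :
    (Polynomial.Chebyshev.U R n).eval x * (w - v) = w ^ (n + 1) - v ^ (n + 1) := by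
  induction n using Nat.twoStepInduction with
  | zero => simp
  | one =>
    simp only [Nat.cast_one, Polynomial.Chebyshev.U_one, Polynomial.eval_mul,
      Polynomial.eval_ofNat, Polynomial.eval_X, ← hadd]
    ring
  | more n ih₀ ih₁ =>
    push_cast at ih₁ ⊢
    simp only [Polynomial.Chebyshev.U_add_two, Polynomial.eval_sub, Polynomial.eval_mul,
      Polynomial.eval_ofNat, Polynomial.eval_X, ← hadd]
    linear_combination (w + v) * ih₁ - ih₀ + (w ^ (n + 1) - v ^ (n + 1)) * hmul

/-- The exact remainder in the exponential approximation of `U (2m+2) x - c * U (2m) x`. -/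
theorem chebyshevU_combination_sub_eq {x : ℝ} (hx : 1 < x) (c : ℝ) (m : ℕ) :
    (Polynomial.Chebyshev.U ℝ (2 * m + 2 : ℕ)).eval x -
        c * (Polynomial.Chebyshev.U ℝ (2 * m : ℕ)).eval x -
        (x + √(x ^ 2 - 1)) ^ (2 * m + 1) *
          (((x + √(x ^ 2 - 1)) ^ 2 - c) / (2 * √(x ^ 2 - 1))) =
      (x - √(x ^ 2 - 1)) ^ (2 * m + 1) * (c - (x - √(x ^ 2 - 1)) ^ 2) /
        (2 * √(x ^ 2 - 1)) := by
  have hpos : 0 < x ^ 2 - 1 := by nlinarith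
  have hs : 0 < √(x ^ 2 - 1) := Real.sqrt_pos.2 hpos
  have hsq : √(x ^ 2 - 1) ^ 2 = x ^ 2 - 1 := Real.sq_sqrt hpos.le
  set s := √(x ^ 2 - 1)
  have hmul : (x + s) * (x - s) = 1 := by linear_combination -hsq
  have hadd : (x + s) + (x - s) = 2 * x := by ring
  have h₀ := chebyshevU_eval_mul_sub hmul hadd (2 * m)
  have h₁ := chebyshevU_eval_mul_sub hmul hadd (2 * m + 2)
  rw [eq_div_iff (by positivity), ← mul_div_assoc, sub_mul, div_mul_cancel₀ _ (by positivity)]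
  linear_combination h₁ - c * h₀


/-- For `1 < ρ₀ ≤ ρ` and `q > 0`, one has, uniformly in `x ∈ [ρ₀, ρ]`,
`U (2n) x - q⁻¹ · U (2n-2) x
  = (x + √(x² - 1))^(2n-1) · ((x + √(x² - 1))² - q⁻¹) / (2√(x² - 1)) + o(1)`
as `n → ∞`. -/
theorem chebyshevU_combination_uniform_approx
    (ρ₀ ρ : ℝ) (hρ₀ : 1 < ρ₀) (hρ : ρ₀ ≤ ρ) (q : ℝ) (hq : 0 < q) :
    ∀ ε > 0, ∃ N : ℕ, ∀ n ≥ N, ∀ x ∈ Set.Icc ρ₀ ρ,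
      |(Polynomial.Chebyshev.U ℝ (2 * (n : ℤ))).eval x -
        q⁻¹ * (Polynomial.Chebyshev.U ℝ (2 * (n : ℤ) - 2)).eval x -
        (x + Real.sqrt (x ^ 2 - 1)) ^ (2 * (n : ℤ) - 1) *
          (((x + Real.sqrt (x ^ 2 - 1)) ^ 2 - q⁻¹) / (2 * Real.sqrt (x ^ 2 - 1)))| < ε := by
  intro ε hε
  have hs₀ : 0 < √(ρ₀ ^ 2 - 1) := Real.sqrt_pos.2 (by nlinarith)
  have hc : 0 < q⁻¹ := inv_pos.2 hq
  have hlim : Filter.Tendsto (fun n : ℕ => ρ₀⁻¹ ^ n * ((q⁻¹ + 1) / (2 * √(ρ₀ ^ 2 - 1))))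
      Filter.atTop (nhds 0) := by
    simpa using (tendsto_pow_atTop_nhds_zero_of_lt_one (by positivity)
      (inv_lt_one_of_one_lt₀ hρ₀)).mul_const ((q⁻¹ + 1) / (2 * √(ρ₀ ^ 2 - 1)))
  obtain ⟨N, hN⟩ := Filter.eventually_atTop.1 (hlim.eventually_lt_const hε)
  refine ⟨N + 1, fun n hn x hx => ?_⟩
  obtain ⟨m, rfl⟩ : ∃ m, n = m + 1 := ⟨n - 1, by omega⟩
  have hx₁ : 1 < x := hρ₀.trans_le hx.1
  have hss : √(ρ₀ ^ 2 - 1) ≤ √(x ^ 2 - 1) := Real.sqrt_le_sqrt (by nlinarith [hx.1])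
  have hs : 0 < √(x ^ 2 - 1) := hs₀.trans_le hss
  have hsq : √(x ^ 2 - 1) ^ 2 = x ^ 2 - 1 := Real.sq_sqrt (by nlinarith)
  have e₁ : 2 * ((m + 1 : ℕ) : ℤ) = (2 * m + 2 : ℕ) := by push_cast; ring
  have e₂ : ((2 * m + 2 : ℕ) : ℤ) - 2 = (2 * m : ℕ) := by push_cast; ring
  have e₃ : ((2 * m + 2 : ℕ) : ℤ) - 1 = (2 * m + 1 : ℕ) := by push_cast; ring
  rw [e₁, e₂, e₃, zpow_natCast, chebyshevU_combination_sub_eq hx₁]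
  refine lt_of_le_of_lt ?_ (hN m (by omega))
  set s := √(x ^ 2 - 1)
  have hmul : (x + s) * (x - s) = 1 := by linear_combination -hsq
  have hv : x - s = (x + s)⁻¹ := eq_inv_of_mul_eq_one_right hmul
  have hv₀ : 0 < x - s := by rw [hv]; positivity
  have hv_le : x - s ≤ ρ₀⁻¹ := by
    rw [hv]
    exact inv_anti₀ (by positivity) (by linarith [hx.1])
  have hρ_inv : ρ₀⁻¹ ≤ 1 := inv_le_one_of_one_le₀ hρ₀.le
  have hfac : |q⁻¹ - (x - s) ^ 2| ≤ q⁻¹ + 1 := by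
    rw [abs_le]
    constructor <;> nlinarith
  have hpow : (x - s) ^ (2 * m + 1) ≤ ρ₀⁻¹ ^ m :=
    (pow_le_pow_of_le_one hv₀.le (hv_le.trans hρ_inv) (by omega)).trans
      (pow_le_pow_left₀ hv₀.le hv_le m)
  rw [mul_div_assoc, abs_mul, abs_div, abs_of_pos (pow_pos hv₀ _),
    abs_of_pos (by positivity : 0 < 2 * s)]
  gcongr
end

section
/- Let q > 1, let ρ > 1, and let ν be a finite Borel measure on [0, ρ] whose topological support contains the point ρ. Set I_n = ∫_0^ρ ( U_{2n}(x) − q^{-1} U_{2n−2}(x) ) dν(x). Then I_n > 0 for all sufficiently large n and (I_n)^{1/(2n)} → ρ + √(ρ² − 1) as n → ∞. -/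
open Filter MeasureTheory

open Polynomial.Chebyshev in
theorem chebyshev_U_eval_succ_of_root {x l m : ℝ} (hs : l + m = 2 * x) (hp : l * m = 1) (n : ℕ) :
    (U ℝ ((n + 1 : ℕ) : ℤ)).eval x = l * (U ℝ (n : ℤ)).eval x + m ^ (n + 1) := by
  induction n with
  | zero => simp [← hs]
  | succ k ih =>
    have h := congrArg (Polynomial.eval x) (U_add_two ℝ (k : ℤ))
    simp only [Polynomial.eval_sub, Polynomial.eval_mul, Polynomial.eval_X,
      Polynomial.eval_ofNat] at h
    push_cast at ih h ⊢
    rw [show (k : ℤ) + 1 + 1 = k + 2 by ring, h, ← hs, ih]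
    linear_combination (U ℝ (k : ℤ)).eval x * hp

theorem one_le_add_sqrt_sq_sub_one {x : ℝ} (hx : 1 ≤ x) : 1 ≤ x + √(x ^ 2 - 1) := by
  have := Real.sqrt_nonneg (x ^ 2 - 1)
  linarith

theorem add_sqrt_sq_sub_one_le {x y : ℝ} (hx : 1 ≤ x) (hxy : x ≤ y) :
    x + √(x ^ 2 - 1) ≤ y + √(y ^ 2 - 1) := by
  gcongr

open Polynomial.Chebyshev in
theorem chebyshev_U_eval_bounds {x : ℝ} (hx : 1 ≤ x) (n : ℕ) :
    (x + √(x ^ 2 - 1)) ^ n ≤ (U ℝ (n : ℤ)).eval x ∧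
    (U ℝ (n : ℤ)).eval x ≤ (n + 1) * (x + √(x ^ 2 - 1)) ^ n ∧
    (U ℝ (n : ℤ)).eval x ≤ (U ℝ ((n + 1 : ℕ) : ℤ)).eval x := by
  have hsq : √(x ^ 2 - 1) ^ 2 = x ^ 2 - 1 := Real.sq_sqrt (by nlinarith)
  have hl := one_le_add_sqrt_sq_sub_one hx
  have hp : (x + √(x ^ 2 - 1)) * (x - √(x ^ 2 - 1)) = 1 := by linear_combination -hsq
  have hrec := chebyshev_U_eval_succ_of_root (x := x)
    (show (x + √(x ^ 2 - 1)) + (x - √(x ^ 2 - 1)) = 2 * x by ring) hp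
  set l := x + √(x ^ 2 - 1)
  set m := x - √(x ^ 2 - 1)
  have hm0 : 0 ≤ m := by
    by_contra! h
    nlinarith
  have hm1 : m ≤ 1 := by nlinarith
  have hlow (n : ℕ) : l ^ n ≤ (U ℝ (n : ℤ)).eval x := by
    induction n with
    | zero => simp
    | succ k ih =>
      rw [hrec, pow_succ']
      have := pow_nonneg hm0 (k + 1)
      nlinarith
  have hup (n : ℕ) : (U ℝ (n : ℤ)).eval x ≤ (n + 1) * l ^ n := by
    induction n with
    | zero => simp
    | succ k ih =>
      rw [hrec]
      have h1 : m ^ (k + 1) ≤ l ^ (k + 1) := pow_le_pow_left₀ hm0 (hm1.trans hl) _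
      have h2 := mul_le_mul_of_nonneg_left ih (zero_le_one.trans hl)
      push_cast
      have h3 : l ^ (k + 1) = l * l ^ k := pow_succ' l k
      rw [h3] at h1 ⊢
      linarith
  refine ⟨hlow n, hup n, ?_⟩
  rw [hrec]
  have h1 := pow_nonneg hm0 (n + 1)
  have h2 : 0 ≤ (U ℝ (n : ℤ)).eval x := (pow_nonneg (zero_le_one.trans hl) n).trans (hlow n)
  nlinarith

open Polynomial.Chebyshev in
theorem abs_chebyshev_U_eval_le {x : ℝ} (hx : |x| ≤ 1) (n : ℕ) :
    |(U ℝ (n : ℤ)).eval x| ≤ n + 1 := by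
  induction n with
  | zero => simp
  | succ k ih =>
    push_cast
    rw [U_eq_X_mul_U_add_T, Polynomial.eval_add, Polynomial.eval_mul, Polynomial.eval_X]
    have h1 := abs_eval_T_real_le_one ((k : ℤ) + 1) hx
    have h2 : |x * (U ℝ (k : ℤ)).eval x| ≤ k + 1 := by
      rw [abs_mul]
      exact (mul_le_of_le_one_left (abs_nonneg _) hx).trans ih
    exact (abs_add_le _ _).trans (by linarith)

theorem eventually_linear_mul_pow_lt_pow {a b : ℝ} (ha : 0 < a) (hab : a < b) (C : ℝ) :
    ∀ᶠ n : ℕ in atTop, (4 * n + 2) * C * a ^ (2 * n) < b ^ (2 * n) := by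
  have hb : 0 < b := ha.trans hab
  have hr0 : 0 ≤ (a / b) ^ 2 := by positivity
  have hr1 : (a / b) ^ 2 < 1 := pow_lt_one₀ (by positivity) ((div_lt_one hb).2 hab) two_ne_zero
  have h1 := tendsto_self_mul_const_pow_of_lt_one hr0 hr1
  have h2 := tendsto_pow_atTop_nhds_zero_of_lt_one hr0 hr1
  have h3 := ((h1.const_mul (4 * C)).add (h2.const_mul (2 * C)))
  simp only [mul_zero, add_zero] at h3
  filter_upwards [h3.eventually_lt_const one_pos] with n hn
  have hbn : 0 < b ^ (2 * n) := by positivity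
  have : (4 * n + 2) * C * a ^ (2 * n) =
      (4 * C * (n * ((a / b) ^ 2) ^ n) + 2 * C * ((a / b) ^ 2) ^ n) * b ^ (2 * n) := by
    rw [← pow_mul, div_pow]
    field_simp
  rw [this]
  exact mul_lt_of_lt_one_left hbn hn

open Polynomial.Chebyshev in
theorem chebyshev_U_sub_bounds {q : ℝ} (hq : 1 < q) (n : ℕ) :
    (∀ x : ℝ, 1 ≤ x →
      (1 - q⁻¹) * (x + √(x ^ 2 - 1)) ^ (2 * (n + 1)) ≤
        (U ℝ (2 * ((n + 1 : ℕ) : ℤ))).eval x - q⁻¹ * (U ℝ (2 * ((n + 1 : ℕ) : ℤ) - 2)).eval x ∧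
      (U ℝ (2 * ((n + 1 : ℕ) : ℤ))).eval x - q⁻¹ * (U ℝ (2 * ((n + 1 : ℕ) : ℤ) - 2)).eval x ≤
        (4 * (n + 1 : ℕ) + 2) * (x + √(x ^ 2 - 1)) ^ (2 * (n + 1))) ∧
    (∀ x : ℝ, |x| ≤ 1 →
      |(U ℝ (2 * ((n + 1 : ℕ) : ℤ))).eval x - q⁻¹ * (U ℝ (2 * ((n + 1 : ℕ) : ℤ) - 2)).eval x| ≤
        4 * (n + 1 : ℕ) + 2) := by
  have e1 : (2 * ((n + 1 : ℕ) : ℤ)) = ((2 * n + 1 + 1 : ℕ) : ℤ) := by push_cast; ring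
  have e2 : (2 * ((n + 1 : ℕ) : ℤ)) - 2 = ((2 * n : ℕ) : ℤ) := by push_cast; ring
  rw [e2, e1]
  have hq0 : 0 < q⁻¹ := by positivity
  have hq1 : q⁻¹ < 1 := inv_lt_one_of_one_lt₀ hq
  refine ⟨fun x hx => ?_, fun x hx => ?_⟩
  · obtain ⟨h1, -, h3⟩ := chebyshev_U_eval_bounds hx (2 * n)
    obtain ⟨-, -, h4⟩ := chebyshev_U_eval_bounds hx (2 * n + 1)
    obtain ⟨h5, h6, -⟩ := chebyshev_U_eval_bounds hx (2 * n + 1 + 1)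
    have hl := one_le_add_sqrt_sq_sub_one hx
    rw [show 2 * (n + 1) = 2 * n + 1 + 1 by ring]
    set l := x + √(x ^ 2 - 1)
    have hl0 : 0 < l := by linarith
    have hp1 : 0 < l ^ (2 * n) := by positivity
    have hp2 : 0 < l ^ (2 * n + 1 + 1) := by positivity
    constructor
    · nlinarith
    · have : 0 ≤ q⁻¹ * (U ℝ ((2 * n : ℕ) : ℤ)).eval x := mul_nonneg hq0.le (hp1.le.trans h1)
      push_cast at *
      nlinarith
  · have h1 := abs_chebyshev_U_eval_le hx (2 * n)
    have h2 := abs_chebyshev_U_eval_le hx (2 * n + 1 + 1)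
    refine (abs_sub _ _).trans ?_
    rw [abs_mul, abs_of_pos hq0]
    have := mul_le_of_le_one_left (abs_nonneg ((U ℝ ((2 * n : ℕ) : ℤ)).eval x)) hq1.le
    push_cast at *
    linarith

/-- Let `q > 1`, `ρ > 1` and let `ν` be a finite Borel measure on
`[0, ρ]` whose topological support contains `ρ`. With
`I n = ∫ (U (2n) x - q⁻¹ U (2n-2) x) dν`, one has `I n > 0` for large `n` and
`(I n)^(1/(2n)) → ρ + √(ρ² - 1)`. -/
theorem chebyshev_integral_root_tendsto
    (q : ℝ) (hq : 1 < q) (ρ : ℝ) (hρ : 1 < ρ)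
    (ν : Measure ℝ) [IsFiniteMeasure ν] (hν : ν (Set.Icc 0 ρ)ᶜ = 0)
    (hsupp : ∀ U ∈ nhds ρ, 0 < ν U)
    (I : ℕ → ℝ)
    (hI : ∀ n, I n = ∫ x in Set.Icc 0 ρ,
      ((Polynomial.Chebyshev.U ℝ (2 * (n : ℤ))).eval x -
        q⁻¹ * (Polynomial.Chebyshev.U ℝ (2 * (n : ℤ) - 2)).eval x) ∂ν) :
    (∀ᶠ n : ℕ in atTop, 0 < I n) ∧
      Tendsto (fun n : ℕ => I n ^ ((1 : ℝ) / (2 * n))) atTop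
        (nhds (ρ + Real.sqrt (ρ ^ 2 - 1))) := by
  have hq1 : 0 < 1 - q⁻¹ := sub_pos.2 (inv_lt_one_of_one_lt₀ hq)
  have hL := one_le_add_sqrt_sq_sub_one hρ.le
  have hint (n : ℕ) : IntegrableOn (fun x : ℝ => (Polynomial.Chebyshev.U ℝ (2 * (n : ℤ))).eval x -
        q⁻¹ * (Polynomial.Chebyshev.U ℝ (2 * (n : ℤ) - 2)).eval x) (Set.Icc 0 ρ) ν :=
    Continuous.integrableOn_Icc (by fun_prop)
  have hupper (n : ℕ) (hn : 1 ≤ n) :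
      I n ≤ (4 * n + 2) * ν.real (Set.Icc 0 ρ) * (ρ + √(ρ ^ 2 - 1)) ^ (2 * n) := by
    obtain ⟨k, rfl⟩ := Nat.exists_eq_add_of_le' hn
    obtain ⟨h1, h2⟩ := chebyshev_U_sub_bounds hq k
    rw [hI]
    have := setIntegral_mono_on (hint (k + 1)) (integrableOn_const (μ := ν) (s := Set.Icc 0 ρ)
      (C := (4 * (k + 1 : ℕ) + 2) * (ρ + √(ρ ^ 2 - 1)) ^ (2 * (k + 1)))) measurableSet_Icc
      (fun x hx => by
        rcases le_total 1 x with h | h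
        · refine (h1 x h).2.trans ?_
          have := add_sqrt_sq_sub_one_le h hx.2
          have := one_le_add_sqrt_sq_sub_one h
          gcongr
        · refine (le_abs_self _).trans ((h2 x (abs_le.2 ⟨by linarith [hx.1], h⟩)).trans ?_)
          exact le_mul_of_one_le_right (by positivity) (one_le_pow₀ hL))
    refine this.trans_eq ?_
    rw [setIntegral_const, smul_eq_mul]
    ring
  have hlower (s : ℝ) (hs1 : 1 ≤ s) (hs : s < ρ) (n : ℕ) (hn : 1 ≤ n) :
      (1 - q⁻¹) * ν.real (Set.Icc s ρ) * (s + √(s ^ 2 - 1)) ^ (2 * n) -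
        (4 * n + 2) * ν.real (Set.Icc 0 ρ) ≤ I n := by
    obtain ⟨k, rfl⟩ := Nat.exists_eq_add_of_le' hn
    obtain ⟨h1, h2⟩ := chebyshev_U_sub_bounds hq k
    rw [hI]
    set A := (1 - q⁻¹) * (s + √(s ^ 2 - 1)) ^ (2 * (k + 1)) with hA
    set B : ℝ := 4 * (k + 1 : ℕ) + 2 with hB
    have hB0 : 0 ≤ B := by positivity
    have hi : IntegrableOn ((Set.Icc s ρ).indicator fun _ => A) (Set.Icc 0 ρ) ν :=
      (integrable_const A).indicator measurableSet_Icc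
    have hc : IntegrableOn (fun _ => B) (Set.Icc 0 ρ) ν := integrable_const B
    have := setIntegral_mono_on (hi.sub hc) (hint (k + 1)) measurableSet_Icc
      (fun x hx => by
        by_cases hxs : x ∈ Set.Icc s ρ
        · simp only [Pi.sub_apply, Set.indicator_of_mem hxs]
          have h3 := (h1 x (hs1.trans hxs.1)).1
          have h4 := add_sqrt_sq_sub_one_le hs1 hxs.1
          have h5 := one_le_add_sqrt_sq_sub_one hs1
          have : A ≤ (1 - q⁻¹) * (x + √(x ^ 2 - 1)) ^ (2 * (k + 1)) := by
            rw [hA]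
            gcongr
          linarith
        · simp only [Pi.sub_apply, Set.indicator_of_notMem hxs]
          rcases le_total 1 x with h | h
          · have h3 := (h1 x h).1
            have h5 := one_le_add_sqrt_sq_sub_one h
            have : 0 ≤ (1 - q⁻¹) * (x + √(x ^ 2 - 1)) ^ (2 * (k + 1)) := by positivity
            linarith
          · have := (abs_le.1 (h2 x (abs_le.2 ⟨by linarith [hx.1], h⟩))).1
            linarith)
    refine le_trans (le_of_eq ?_) this
    simp only [Pi.sub_apply]
    rw [integral_sub hi hc, setIntegral_indicator measurableSet_Icc,
      Set.inter_eq_right.2 (Set.Icc_subset_Icc_left (zero_le_one.trans hs1)),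
      setIntegral_const, setIntegral_const, smul_eq_mul, smul_eq_mul, hA]
    ring
  have hpos (s : ℝ) (hs : s < ρ) : 0 < ν.real (Set.Icc s ρ) := by
    refine ENNReal.toReal_pos (fun h => ?_) (measure_ne_top _ _)
    refine (hsupp _ (Ioi_mem_nhds hs)).ne' (measure_mono_null (fun x hx => ?_)
      (measure_union_null h hν))
    by_cases hxρ : x ≤ ρ
    · exact Or.inl ⟨le_of_lt hx, hxρ⟩
    · exact Or.inr fun h => hxρ h.2
  have hev (a : ℝ) (ha : 1 ≤ a) (haL : a < ρ + √(ρ ^ 2 - 1)) :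
      ∀ᶠ n : ℕ in atTop, a ^ (2 * n) < I n := by
    have hcont : ContinuousAt (fun x : ℝ => x + √(x ^ 2 - 1)) ρ := by fun_prop
    obtain ⟨s, hsa, hs1, hsρ⟩ := (((hcont.eventually_const_lt haL).filter_mono
      nhdsWithin_le_nhds).and (Ioo_mem_nhdsLT hρ)).exists
    have hν0 : 0 < ν.real (Set.Icc s ρ) := hpos s hsρ
    have hc : 0 < (1 - q⁻¹) * ν.real (Set.Icc s ρ) := mul_pos hq1 hν0
    filter_upwards [eventually_linear_mul_pow_lt_pow (by linarith) hsa
      ((ν.real (Set.Icc 0 ρ) + 1) / ((1 - q⁻¹) * ν.real (Set.Icc s ρ))),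
      eventually_ge_atTop 1] with n h1 hn
    refine lt_of_lt_of_le ?_ (hlower s hs1.le hsρ n hn)
    set c := (1 - q⁻¹) * ν.real (Set.Icc s ρ)
    set V := ν.real (Set.Icc 0 ρ)
    have hV : 0 ≤ V := measureReal_nonneg
    have h2 := mul_lt_mul_of_pos_left h1 hc
    have h3 : c * ((4 * n + 2) * ((V + 1) / c) * a ^ (2 * n)) =
        (4 * n + 2) * V * a ^ (2 * n) + (4 * n + 2) * a ^ (2 * n) := by
      field_simp
    have ha1 : 1 ≤ a ^ (2 * n) := one_le_pow₀ ha
    have h4 : (4 * n + 2) * V ≤ (4 * n + 2) * V * a ^ (2 * n) :=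
      le_mul_of_one_le_right (by positivity) ha1
    have h5 : 0 ≤ (4 * n + 1) * a ^ (2 * n) := by positivity
    linarith
  have hL1 : 1 < ρ + √(ρ ^ 2 - 1) := by linarith [Real.sqrt_nonneg (ρ ^ 2 - 1)]
  have hIpos : ∀ᶠ n : ℕ in atTop, 0 < I n := by
    filter_upwards [hev 1 le_rfl hL1] with n hn
    exact (by positivity : (0 : ℝ) < 1 ^ (2 * n)).trans hn
  have hroot (b : ℝ) (hb : 0 ≤ b) (n : ℕ) (hn : 1 ≤ n) :
      (b ^ (2 * n)) ^ ((1 : ℝ) / (2 * n)) = b := by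
    have := Real.pow_rpow_inv_natCast hb (n := 2 * n) (by omega)
    simpa [one_div] using this
  refine ⟨hIpos, tendsto_order.2 ⟨fun a ha => ?_, fun b hb => ?_⟩⟩
  · filter_upwards [hev (max a 1) (le_max_right _ _) (max_lt ha hL1), eventually_ge_atTop 1]
      with n h hn
    have hm : (0 : ℝ) ≤ max a 1 := zero_le_one.trans (le_max_right _ _)
    refine (le_max_left a 1).trans_lt ?_
    rw [← hroot (max a 1) hm n hn]
    have : (0 : ℝ) < n := by exact_mod_cast hn
    exact Real.rpow_lt_rpow (by positivity) h (by positivity)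
  · filter_upwards [eventually_linear_mul_pow_lt_pow (by linarith) hb (ν.real (Set.Icc 0 ρ)),
      hIpos, eventually_ge_atTop 1] with n h hp hn
    have : (0 : ℝ) < n := by exact_mod_cast hn
    refine (Real.rpow_lt_rpow hp.le ((hupper n hn).trans_lt h) (by positivity)).trans_eq ?_
    exact hroot b (by linarith) n hn
end

section
/- Let q > 1, let ρ > 1, and let ν be a finite Borel measure on [0, ρ] whose topological support contains the point ρ. Set I_n = ∫_0^ρ ( U_{2n}(x) − q^{-1} U_{2n−2}(x) ) dν(x). Then I_n > 0 for all sufficiently large n and I_{n+1}/I_n → (ρ + √(ρ² − 1))² as n → ∞. -/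
open Filter MeasureTheory

open Polynomial in
theorem eval_U_add_two (x : ℝ) (m : ℕ) :
    (Chebyshev.U ℝ ((m + 2 : ℕ) : ℤ)).eval x =
      2 * x * (Chebyshev.U ℝ ((m + 1 : ℕ) : ℤ)).eval x - (Chebyshev.U ℝ (m : ℤ)).eval x := by
  push_cast
  rw [Chebyshev.U_add_two]
  simp

open Polynomial in
theorem eval_U_succ_of_joukowski {x u : ℝ} (hu : 1 ≤ u) (hx : 2 * x = u + u⁻¹) (m : ℕ) :
    (Chebyshev.U ℝ ((m + 1 : ℕ) : ℤ)).eval x =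
      u * (Chebyshev.U ℝ (m : ℤ)).eval x + u⁻¹ ^ (m + 1) := by
  have hu0 : u ≠ 0 := by positivity
  induction m with
  | zero => simp [hx]
  | succ m ih =>
    rw [eval_U_add_two, hx]
    have h : u⁻¹ ^ (m + 1 + 1) = u⁻¹ * ((Chebyshev.U ℝ ((m + 1 : ℕ) : ℤ)).eval x -
        u * (Chebyshev.U ℝ (m : ℤ)).eval x) := by
      rw [ih]; ring
    rw [h]
    field_simp
    ring

open Polynomial in
theorem pow_le_eval_U_of_joukowski {x u : ℝ} (hu : 1 ≤ u) (hx : 2 * x = u + u⁻¹) (m : ℕ) :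
    u ^ m ≤ (Chebyshev.U ℝ (m : ℤ)).eval x := by
  induction m with
  | zero => simp
  | succ m ih =>
    rw [eval_U_succ_of_joukowski hu hx, pow_succ']
    have h₁ : 0 ≤ u⁻¹ ^ (m + 1) := by positivity
    have h₂ := mul_le_mul_of_nonneg_left ih (zero_le_one.trans hu)
    linarith

open Polynomial in
theorem eval_U_le_of_joukowski {x u : ℝ} (hu : 1 ≤ u) (hx : 2 * x = u + u⁻¹) (m : ℕ) :
    (Chebyshev.U ℝ (m : ℤ)).eval x ≤ (m + 1) * u ^ m := by
  induction m with
  | zero => simp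
  | succ m ih =>
    rw [eval_U_succ_of_joukowski hu hx]
    have h₁ : u⁻¹ ^ (m + 1) ≤ 1 := pow_le_one₀ (by positivity) (inv_le_one_of_one_le₀ hu)
    have h₂ := mul_le_mul_of_nonneg_left ih (zero_le_one.trans hu)
    have h₃ : 1 ≤ u ^ (m + 1) := one_le_pow₀ hu
    calc _ ≤ u * ((m + 1) * u ^ m) + u ^ (m + 1) := by linarith
      _ = _ := by push_cast; ring

open Polynomial in
theorem eval_U_le_eval_U_succ {x u : ℝ} (hu : 1 ≤ u) (hx : 2 * x = u + u⁻¹) (m : ℕ) :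
    (Chebyshev.U ℝ (m : ℤ)).eval x ≤ (Chebyshev.U ℝ ((m + 1 : ℕ) : ℤ)).eval x := by
  rw [eval_U_succ_of_joukowski hu hx]
  have h₁ : 0 ≤ u⁻¹ ^ (m + 1) := by positivity
  have h₂ : 0 ≤ (Chebyshev.U ℝ (m : ℤ)).eval x :=
    le_trans (by positivity) (pow_le_eval_U_of_joukowski hu hx m)
  nlinarith

open Polynomial in
theorem abs_eval_U_le_of_abs_le_one {x : ℝ} (hx : |x| ≤ 1) (m : ℕ) :
    |(Chebyshev.U ℝ (m : ℤ)).eval x| ≤ m + 1 := by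
  induction m with
  | zero => simp
  | succ m ih =>
    have h : (Chebyshev.U ℝ ((m + 1 : ℕ) : ℤ)).eval x =
        x * (Chebyshev.U ℝ (m : ℤ)).eval x + (Chebyshev.T ℝ ((m : ℤ) + 1)).eval x := by
      push_cast
      rw [Chebyshev.U_eq_X_mul_U_add_T]
      simp
    have hT : |(Chebyshev.T ℝ ((m : ℤ) + 1)).eval x| ≤ 1 :=
      Chebyshev.abs_eval_T_real_le_one _ hx
    rw [h]
    refine (abs_add_le _ _).trans ?_
    rw [abs_mul]
    have := mul_le_mul hx ih (abs_nonneg _) zero_le_one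
    push_cast
    linarith

theorem two_mul_eq_joukowski {x : ℝ} (hx : 1 ≤ x) :
    2 * x = (x + √(x ^ 2 - 1)) + (x + √(x ^ 2 - 1))⁻¹ := by
  have h := one_le_add_sqrt_sq_sub_one hx
  have hs : √(x ^ 2 - 1) ^ 2 = x ^ 2 - 1 := Real.sq_sqrt (by nlinarith)
  have : (x + √(x ^ 2 - 1))⁻¹ = x - √(x ^ 2 - 1) := by
    refine inv_eq_of_mul_eq_one_right ?_
    linear_combination -hs
  rw [this]; ring

open Polynomial in
theorem abs_eval_U_le {x a : ℝ} (ha : 1 ≤ a) (hx0 : 0 ≤ x) (hxa : x ≤ a) (m : ℕ) :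
    |(Chebyshev.U ℝ (m : ℤ)).eval x| ≤ (m + 1) * (a + √(a ^ 2 - 1)) ^ m := by
  rcases le_total x 1 with h | h
  · refine (abs_eval_U_le_of_abs_le_one (abs_le.2 ⟨by linarith, h⟩) m).trans ?_
    exact le_mul_of_one_le_right (by positivity) (one_le_pow₀ (one_le_add_sqrt_sq_sub_one ha))
  · have hu := one_le_add_sqrt_sq_sub_one h
    have hj := two_mul_eq_joukowski h
    rw [abs_of_nonneg (le_trans (by positivity) (pow_le_eval_U_of_joukowski hu hj m))]
    refine (eval_U_le_of_joukowski hu hj m).trans ?_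
    have := add_sqrt_sq_sub_one_le h hxa
    gcongr

/-- The function `U (2n+2) - t * U (2n)`. -/
noncomputable def chebyshevUDiff (t : ℝ) (n : ℕ) (x : ℝ) : ℝ :=
  (Polynomial.Chebyshev.U ℝ ((2 * n + 2 : ℕ) : ℤ)).eval x -
    t * (Polynomial.Chebyshev.U ℝ ((2 * n : ℕ) : ℤ)).eval x

theorem continuous_chebyshevUDiff (t : ℝ) (n : ℕ) : Continuous (chebyshevUDiff t n) := by
  unfold chebyshevUDiff
  fun_prop

theorem abs_chebyshevUDiff_le {t x a : ℝ} (ht0 : 0 ≤ t) (ht1 : t ≤ 1) (ha : 1 ≤ a) (hx0 : 0 ≤ x)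
    (hxa : x ≤ a) (n : ℕ) :
    |chebyshevUDiff t n x| ≤ 4 * (n + 1) * ((a + √(a ^ 2 - 1)) ^ 2) ^ (n + 1) := by
  have h₁ := abs_eval_U_le ha hx0 hxa (2 * n + 2)
  have h₂ := abs_eval_U_le ha hx0 hxa (2 * n)
  have hu := one_le_add_sqrt_sq_sub_one ha
  set u := a + √(a ^ 2 - 1)
  have hp : u ^ (2 * n) ≤ u ^ (2 * n + 2) := pow_le_pow_right₀ hu (by omega)
  have h₃ : |(Polynomial.Chebyshev.U ℝ ((2 * n : ℕ) : ℤ)).eval x| ≤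
      (2 * n + 1) * u ^ (2 * n + 2) := by
    refine h₂.trans ?_
    push_cast
    gcongr
  have h₄ := mul_le_mul ht1 h₃ (abs_nonneg _) zero_le_one
  have he : (u ^ 2) ^ (n + 1) = u ^ (2 * n + 2) := by rw [← pow_mul]; ring_nf
  unfold chebyshevUDiff
  refine (abs_sub _ _).trans ?_
  rw [abs_mul, abs_of_nonneg ht0, he]
  push_cast at h₁ h₄ ⊢
  linarith

theorem le_chebyshevUDiff {t x : ℝ} (ht1 : t ≤ 1) (hx : 1 ≤ x) (n : ℕ) :
    (1 - t) * ((x + √(x ^ 2 - 1)) ^ 2) ^ n ≤ chebyshevUDiff t n x := by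
  have hu := one_le_add_sqrt_sq_sub_one hx
  have hj := two_mul_eq_joukowski hx
  have h₁ := pow_le_eval_U_of_joukowski hu hj (2 * n)
  have h₂ := eval_U_le_eval_U_succ hu hj (2 * n)
  have h₃ := eval_U_le_eval_U_succ hu hj (2 * n + 1)
  have h₄ := mul_le_mul_of_nonneg_left h₁ (sub_nonneg.2 ht1)
  unfold chebyshevUDiff
  rw [← pow_mul]
  linarith

theorem abs_chebyshevUDiff_succ_sub_le {t x : ℝ} (ht0 : 0 ≤ t) (ht1 : t ≤ 1) (hx : 1 ≤ x)
    (n : ℕ) :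
    |chebyshevUDiff t (n + 1) x - (x + √(x ^ 2 - 1)) ^ 2 * chebyshevUDiff t n x| ≤ 2 := by
  have hu := one_le_add_sqrt_sq_sub_one hx
  have hj := two_mul_eq_joukowski hx
  set u := x + √(x ^ 2 - 1)
  have key : ∀ m : ℕ, ∃ e : ℝ, 0 ≤ e ∧ e ≤ 2 ∧
      (Polynomial.Chebyshev.U ℝ ((m + 2 : ℕ) : ℤ)).eval x =
        u ^ 2 * (Polynomial.Chebyshev.U ℝ (m : ℤ)).eval x + e := by
    intro m
    have hi0 : 0 ≤ u⁻¹ := by positivity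
    have hi1 : u⁻¹ ≤ 1 := inv_le_one_of_one_le₀ hu
    have hui : u * u⁻¹ = 1 := mul_inv_cancel₀ (by positivity)
    refine ⟨u⁻¹ ^ m + u⁻¹ ^ (m + 2), by positivity, ?_, ?_⟩
    · have := pow_le_one₀ (n := m) hi0 hi1
      have := pow_le_one₀ (n := m + 2) hi0 hi1
      linarith
    · have h₁ := eval_U_succ_of_joukowski hu hj m
      have h₂ := eval_U_succ_of_joukowski hu hj (m + 1)
      rw [h₂, h₁]
      linear_combination u⁻¹ ^ m * hui
  obtain ⟨e, he0, he2, he⟩ := key (2 * n + 2)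
  obtain ⟨d, hd0, hd2, hd⟩ := key (2 * n)
  unfold chebyshevUDiff
  rw [show 2 * (n + 1) + 2 = 2 * n + 2 + 2 by ring, show 2 * (n + 1) = 2 * n + 2 by ring, he]
  have h : ∀ A B : ℝ, A = u ^ 2 * B + d →
      u ^ 2 * A + e - t * A - u ^ 2 * (A - t * B) = e - t * d := by
    rintro A B h
    rw [h]; ring
  rw [h _ _ hd, abs_le]
  constructor <;> nlinarith

theorem eventually_mul_pow_le {r s : ℝ} (hr : 0 ≤ r) (hrs : r < s) (K : ℝ) {c : ℝ} (hc : 0 < c) :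
    ∀ᶠ n : ℕ in atTop, K * ((n + 1) * r ^ n) ≤ c * s ^ n := by
  have hs : 0 < s := hr.trans_lt hrs
  have h₁ := tendsto_self_mul_const_pow_of_lt_one (div_nonneg hr hs.le) ((div_lt_one hs).2 hrs)
  have h₂ := tendsto_pow_atTop_nhds_zero_of_lt_one (div_nonneg hr hs.le) ((div_lt_one hs).2 hrs)
  have h₃ := (h₁.add h₂).const_mul K
  rw [add_zero, mul_zero] at h₃
  filter_upwards [h₃.eventually_lt_const hc] with n hn
  have hsn : 0 < s ^ n := by positivity
  have := mul_le_mul_of_nonneg_right hn.le hsn.le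
  rw [div_pow] at this
  calc K * ((n + 1) * r ^ n) =
      K * (n * (r ^ n / s ^ n) + r ^ n / s ^ n) * s ^ n := by field_simp
    _ ≤ _ := this

theorem eventually_chebyshevUDiff_integral {t ρ : ℝ} (ht0 : 0 ≤ t) (ht1 : t < 1) (hρ : 1 < ρ)
    (μ : Measure ℝ) [IsFiniteMeasure μ] (hμ : ∀ᵐ x ∂μ, x ∈ Set.Icc 0 ρ)
    (hpos : ∀ b < ρ, 0 < μ.real (Set.Icc b ρ)) {ε : ℝ} (hε : 0 < ε) :
    ∀ᶠ n : ℕ in atTop, 0 < ∫ x, chebyshevUDiff t n x ∂μ ∧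
      |(∫ x, chebyshevUDiff t (n + 1) x ∂μ) -
        (ρ + √(ρ ^ 2 - 1)) ^ 2 * ∫ x, chebyshevUDiff t n x ∂μ| ≤
          2 * ε * ∫ x, chebyshevUDiff t n x ∂μ := by
  have hint : ∀ n, Integrable (chebyshevUDiff t n) μ := by
    intro n
    refine Integrable.of_bound (continuous_chebyshevUDiff t n).aestronglyMeasurable
      (4 * (n + 1) * ((ρ + √(ρ ^ 2 - 1)) ^ 2) ^ (n + 1)) ?_
    filter_upwards [hμ] with x hx
    exact abs_chebyshevUDiff_le ht0 ht1.le hρ.le hx.1 hx.2 n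
  set L : ℝ := (ρ + √(ρ ^ 2 - 1)) ^ 2 with hL
  obtain ⟨a, ha1, haρ, ha⟩ : ∃ a, 1 < a ∧ a < ρ ∧ ∀ x ∈ Set.Icc a ρ,
      |(x + √(x ^ 2 - 1)) ^ 2 - L| ≤ ε := by
    have hc : Continuous fun x : ℝ => (x + √(x ^ 2 - 1)) ^ 2 := by fun_prop
    obtain ⟨δ, hδ, h⟩ := Metric.continuousAt_iff.1 (hc.continuousAt (x := ρ)) ε hε
    refine ⟨max ((1 + ρ) / 2) (ρ - δ / 2), lt_max_of_lt_left (by linarith),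
      max_lt (by linarith) (by linarith), fun x hx => ?_⟩
    have hx' := (le_max_right _ _).trans hx.1
    refine (h (x := x) ?_).le
    rw [Real.dist_eq, abs_lt]
    constructor <;> linarith [hx.2]
  obtain ⟨b, hab, hbρ⟩ := exists_between haρ
  have hua := one_le_add_sqrt_sq_sub_one ha1.le
  have hr1 : 1 ≤ (a + √(a ^ 2 - 1)) ^ 2 := one_le_pow₀ hua
  have hrs : (a + √(a ^ 2 - 1)) ^ 2 < (b + √(b ^ 2 - 1)) ^ 2 := by
    have : √(a ^ 2 - 1) ≤ √(b ^ 2 - 1) := by gcongr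
    exact pow_lt_pow_left₀ (by linarith) (by linarith) two_ne_zero
  have hbound := fun x (hx0 : 0 ≤ x) (hxa : x ≤ a) (n : ℕ) =>
    abs_chebyshevUDiff_le ht0 ht1.le ha1.le hx0 hxa n
  set r := (a + √(a ^ 2 - 1)) ^ 2
  set s := (b + √(b ^ 2 - 1)) ^ 2 with hs
  have hL0 : 0 ≤ L := by positivity
  set K := 8 * r ^ 2 + 4 * (L + ε) * r + 4 * r with hK
  have hlow : ∀ n : ℕ, ∀ x ∈ Set.Icc 0 ρ,
      (Set.Icc b ρ).indicator (fun _ => (1 - t) * s ^ n) x - K * ((n + 1) * r ^ n) ≤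
        chebyshevUDiff t n x := by
    intro n x hx
    have hK0 : 4 * (n + 1) * r ^ (n + 1) ≤ K * ((n + 1) * r ^ n) := by
      have : 0 ≤ (8 * r ^ 2 + 4 * (L + ε) * r) * ((n + 1) * r ^ n) := by positivity
      rw [hK, pow_succ]; linarith
    have hK1 : 0 ≤ K * ((n + 1) * r ^ n) := by positivity
    by_cases hxb : x ∈ Set.Icc b ρ
    · rw [Set.indicator_of_mem hxb]
      have hb1 : 1 ≤ b := by linarith
      have h₁ := le_chebyshevUDiff ht1.le (hb1.trans hxb.1) n
      have h₂ : s ≤ (x + √(x ^ 2 - 1)) ^ 2 := by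
        have := add_sqrt_sq_sub_one_le hb1 hxb.1
        have := one_le_add_sqrt_sq_sub_one hb1
        rw [hs]; gcongr
      have h₃ : (1 - t) * s ^ n ≤ (1 - t) * ((x + √(x ^ 2 - 1)) ^ 2) ^ n := by
        have : 0 ≤ 1 - t := by linarith
        gcongr
      linarith
    · rw [Set.indicator_of_notMem hxb]
      rcases le_total x a with h | h
      · linarith [neg_abs_le (chebyshevUDiff t n x), hbound x hx.1 h n]
      · have h₁ := le_chebyshevUDiff ht1.le (ha1.le.trans h) n
        have h₂ : 0 ≤ (1 - t) * ((x + √(x ^ 2 - 1)) ^ 2) ^ n :=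
          mul_nonneg (by linarith) (by positivity)
        linarith
  have hdiff : ∀ n : ℕ, ∀ x ∈ Set.Icc 0 ρ,
      |chebyshevUDiff t (n + 1) x - L * chebyshevUDiff t n x| ≤
        ε * chebyshevUDiff t n x + K * ((n + 1) * r ^ n) := by
    intro n x hx
    rcases le_total x a with h | h
    · have h₀ := hbound x hx.1 h n
      have h₁ := hbound x hx.1 h (n + 1)
      have h₂ := abs_sub (chebyshevUDiff t (n + 1) x) (L * chebyshevUDiff t n x)
      rw [abs_mul, abs_of_nonneg hL0] at h₂
      have h₃ := mul_le_mul_of_nonneg_left h₀ (add_nonneg hL0 hε.le)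
      have h₄ := mul_le_mul_of_nonneg_left (neg_abs_le (chebyshevUDiff t n x)) hε.le
      have h₅ : 4 * ((n + 1 : ℕ) + 1) * r ^ (n + 1 + 1) ≤ 8 * r ^ 2 * ((n + 1) * r ^ n) := by
        have : 0 ≤ (n : ℝ) * (r ^ 2 * r ^ n) := by positivity
        push_cast
        rw [show r ^ (n + 1 + 1) = r ^ 2 * r ^ n by ring]
        linarith
      have h₆ : 0 ≤ 4 * r * ((n + 1) * r ^ n) := by positivity
      rw [hK]
      rw [pow_succ r n] at h₃
      linarith
    · have hx1 := ha1.le.trans h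
      have h₀ := le_chebyshevUDiff ht1.le hx1 n
      have hg : 0 ≤ chebyshevUDiff t n x :=
        le_trans (mul_nonneg (by linarith) (by positivity)) h₀
      have h₁ := abs_chebyshevUDiff_succ_sub_le ht0 ht1.le hx1 n
      have h₂ := mul_le_mul_of_nonneg_right (ha x ⟨h, hx.2⟩) hg
      have h₃ : 2 ≤ K * ((n + 1) * r ^ n) := by
        have hk : 2 ≤ K := by
          have : 0 ≤ 4 * (L + ε) * r := by positivity
          nlinarith
        have he : 1 ≤ (n + 1) * r ^ n :=
          one_le_mul_of_one_le_of_one_le (by linarith [(n.cast_nonneg : (0 : ℝ) ≤ n)])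
            (one_le_pow₀ hr1)
        exact hk.trans (le_mul_of_one_le_right (by linarith) he)
      have h₄ : chebyshevUDiff t (n + 1) x - L * chebyshevUDiff t n x =
          (chebyshevUDiff t (n + 1) x - (x + √(x ^ 2 - 1)) ^ 2 * chebyshevUDiff t n x) +
            ((x + √(x ^ 2 - 1)) ^ 2 - L) * chebyshevUDiff t n x := by ring
      rw [h₄]
      refine (abs_add_le _ _).trans ?_
      rw [abs_mul _ (chebyshevUDiff t n x), abs_of_nonneg hg]
      linarith
  set M := μ.real Set.univ
  set w := μ.real (Set.Icc b ρ)
  have hw : 0 < w := hpos b hbρ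
  have hlowI : ∀ n : ℕ, w * ((1 - t) * s ^ n) - M * (K * ((n + 1) * r ^ n)) ≤
      ∫ x, chebyshevUDiff t n x ∂μ := by
    intro n
    have hi : Integrable ((Set.Icc b ρ).indicator (fun _ => (1 - t) * s ^ n)) μ :=
      (integrable_const _).indicator measurableSet_Icc
    have := integral_mono_ae (hi.sub (integrable_const (K * ((n + 1) * r ^ n)))) (hint n)
      (hμ.mono fun x hx => hlow n x hx)
    rwa [integral_sub' hi (integrable_const _), integral_indicator_const _ measurableSet_Icc,
      integral_const, smul_eq_mul, smul_eq_mul] at this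
  have hdiffI : ∀ n : ℕ, |(∫ x, chebyshevUDiff t (n + 1) x ∂μ) -
      L * ∫ x, chebyshevUDiff t n x ∂μ| ≤
        ε * (∫ x, chebyshevUDiff t n x ∂μ) + M * (K * ((n + 1) * r ^ n)) := by
    intro n
    have hd := (hint (n + 1)).sub ((hint n).const_mul L)
    rw [← integral_const_mul, ← integral_sub (hint (n + 1)) ((hint n).const_mul L)]
    refine abs_integral_le_integral_abs.trans ?_
    have := integral_mono_ae hd.abs
      (((hint n).const_mul ε).add (integrable_const (K * ((n + 1) * r ^ n))))
      (hμ.mono fun x hx => hdiff n x hx)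
    rwa [integral_add' ((hint n).const_mul ε) (integrable_const _), integral_const_mul,
      integral_const, smul_eq_mul] at this
  have hc : 0 < w * (1 - t) := mul_pos hw (by linarith)
  have hr0 : 0 ≤ r := by linarith
  have hs0 : 0 < s := by linarith
  filter_upwards [eventually_mul_pow_le hr0 hrs (M * K) (half_pos hc),
    eventually_mul_pow_le hr0 hrs (M * K) (mul_pos hε (half_pos hc))] with n h₁ h₂
  have h₃ := hlowI n
  have h₄ := hdiffI n
  have hsn : 0 < w * (1 - t) / 2 * s ^ n := by positivity
  have h₅ : w * (1 - t) / 2 * s ^ n ≤ ∫ x, chebyshevUDiff t n x ∂μ := by linarith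
  have h₆ := mul_le_mul_of_nonneg_left h₅ hε.le
  exact ⟨hsn.trans_le h₅, by linarith⟩

/-- Let `q > 1`, `ρ > 1` and let `ν` be a finite Borel measure on
`[0, ρ]` whose topological support contains `ρ`. With
`I n = ∫ (U (2n) x - q⁻¹ U (2n-2) x) dν`, one has `I n > 0` for large `n` and
`I (n+1) / I n → (ρ + √(ρ² - 1))²`. -/
theorem chebyshev_integral_ratio_tendsto
    (q : ℝ) (hq : 1 < q) (ρ : ℝ) (hρ : 1 < ρ)
    (ν : Measure ℝ) [IsFiniteMeasure ν] (hν : ν (Set.Icc 0 ρ)ᶜ = 0)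
    (hsupp : ∀ U ∈ nhds ρ, 0 < ν U)
    (I : ℕ → ℝ)
    (hI : ∀ n, I n = ∫ x in Set.Icc 0 ρ,
      ((Polynomial.Chebyshev.U ℝ (2 * (n : ℤ))).eval x -
        q⁻¹ * (Polynomial.Chebyshev.U ℝ (2 * (n : ℤ) - 2)).eval x) ∂ν) :
    (∀ᶠ n : ℕ in atTop, 0 < I n) ∧
      Tendsto (fun n : ℕ => I (n + 1) / I n) atTop
        (nhds ((ρ + Real.sqrt (ρ ^ 2 - 1)) ^ 2)) := by
  have hmem : ∀ᵐ x ∂ν, x ∈ Set.Icc 0 ρ := hν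
  have hrestrict : ν.restrict (Set.Icc 0 ρ) = ν := Measure.restrict_eq_self_of_ae_mem hmem
  have hJ : ∀ n : ℕ, I (n + 1) = ∫ x, chebyshevUDiff q⁻¹ n x ∂ν := by
    intro n
    rw [hI, hrestrict]
    unfold chebyshevUDiff
    push_cast
    rw [show 2 * ((n : ℤ) + 1) - 2 = 2 * n by ring, show 2 * ((n : ℤ) + 1) = 2 * n + 2 by ring]
  have hpos : ∀ b < ρ, 0 < ν.real (Set.Icc b ρ) := by
    intro b hb
    refine ENNReal.toReal_pos ((hsupp _ (Ioi_mem_nhds hb)).trans_le ?_).ne' (measure_ne_top _ _)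
    refine measure_mono_ae ?_
    filter_upwards [hmem] with x hx hxb
    exact ⟨le_of_lt hxb, hx.2⟩
  have key := fun (ε : ℝ) (hε : 0 < ε) => eventually_chebyshevUDiff_integral
    (inv_nonneg.2 (zero_le_one.trans hq.le)) (inv_lt_one_of_one_lt₀ hq) hρ ν hmem hpos hε
  simp only [← hJ] at key
  constructor
  · rw [← map_add_atTop_eq_nat 1, eventually_map]
    exact (key 1 one_pos).mono fun n hn => hn.1
  · rw [← tendsto_add_atTop_iff_nat 1, Metric.tendsto_nhds]
    intro ε hε
    filter_upwards [key (ε / 4) (by positivity)] with n ⟨hn, h⟩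
    rw [Real.dist_eq, div_sub' hn.ne', abs_div, abs_of_pos hn, div_lt_iff₀ hn, mul_comm (I (n + 1))]
    refine h.trans_lt ?_
    nlinarith
end

section
/- Let r ≥ 2, q = 2r − 1, and let N be a normal subgroup of the free group F_r on r generators. Let γ_n be the number of elements of N of reduced length n, and let W_n be the number of n-tuples (s_1,…,s_n) of generators and inverses whose product lies in N. Then for all complex z of sufficiently small nonzero modulus, (z/(1 − z²))·Σ_{n≥0} γ_n z^n = Σ_{n≥0} W_n · ( z/(q z² + 1) )^{n+1}, both series converging absolutely. -/
open Filter Topology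

namespace FreeGroup

/-- The letter `(a, b)` as an element of the free group: `a` if `b` is true, `a⁻¹` otherwise. -/
abbrev letter {α : Type*} (s : α × Bool) : FreeGroup α :=
  if s.2 then of s.1 else (of s.1)⁻¹

theorem letter_eq_mk {α : Type*} (s : α × Bool) : letter s = mk [s] := by
  obtain ⟨a, b⟩ := s
  cases b <;> simp [letter, of, invRev]

theorem norm_letter_mul {α : Type*} [DecidableEq α] (s : α × Bool) {y : FreeGroup α}
    {c : α × Bool} {l : List (α × Bool)} (h : y.toWord = c :: l) :
    norm (letter s * y) = if s = (c.1, !c.2) then l.length else l.length + 2 := by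
  have hy : y = mk (c :: l) := by rw [← h, mk_toWord]
  have hred : reduce (c :: l) = c :: l := by rw [← h, reduce_toWord]
  rw [letter_eq_mk, hy, mul_mk, norm, toWord_mk, List.singleton_append, reduce.cons, hred]
  simp only [Prod.ext_iff]
  split_ifs <;> simp

theorem sum_pow_norm_letter_mul {α : Type*} [Fintype α] [DecidableEq α] (z : ℂ)
    (y : FreeGroup α) :
    ((2 * (Fintype.card α : ℂ) - 1) * z ^ 2 + 1) * z ^ norm y =
      (if y = 1 then 1 - z ^ 2 else 0) + z * ∑ s : α × Bool, z ^ norm (letter s * y) := by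
  by_cases hy : y = 1
  · subst hy
    have h (s : α × Bool) : norm (letter s) = 1 := by
      obtain ⟨a, b⟩ := s
      cases b <;> simp [letter]
    simp [h]
    ring
  · obtain ⟨c, l, hcl⟩ := List.exists_cons_of_ne_nil (mt toWord_eq_nil_iff.mp hy)
    have hn : norm y = l.length + 1 := by simp [norm, hcl]
    have h (s : α × Bool) : z ^ norm (letter s * y) =
        z ^ (l.length + 2) + if s = (c.1, !c.2) then z ^ l.length - z ^ (l.length + 2) else 0 := by
      rw [norm_letter_mul s hcl]
      split_ifs <;> ring
    simp only [h, Finset.sum_add_distrib, Finset.sum_ite_eq', Finset.mem_univ, hn, hy]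
    simp
    ring

theorem summable_pow_length {α : Type*} [Fintype α] {t : ℝ} (ht : 0 ≤ t)
    (h : Fintype.card α * t < 1) : Summable fun l : List α => t ^ l.length := by
  rw [← (Equiv.sigmaFiberEquiv (List.length (α := α))).summable_iff,
    summable_sigma_of_nonneg fun _ => by simpa using pow_nonneg ht _]
  have key (n : ℕ) (l : {l : List α // l.length = n}) : t ^ l.1.length = t ^ n := by rw [l.2]
  constructor
  · intro n
    have : Finite {l : List α // l.length = n} := inferInstanceAs (Finite (List.Vector α n))
    exact Summable.of_finite
  · simp only [Function.comp_apply, Equiv.sigmaFiberEquiv_apply, key, tsum_const]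
    refine (summable_geometric_of_lt_one (by positivity) h).congr fun n => ?_
    have : Nat.card {l : List α // l.length = n} = Fintype.card α ^ n := by
      rw [← card_vector n, ← Nat.card_eq_fintype_card]
      rfl
    rw [this, nsmul_eq_mul, mul_pow]
    push_cast
    ring

theorem summable_pow_norm {α : Type*} [Fintype α] [DecidableEq α] {z : ℂ}
    (h : 2 * Fintype.card α * ‖z‖ < 1) : Summable fun x : FreeGroup α => z ^ norm x := by
  refine Summable.of_norm ?_
  simp only [norm_pow]
  refine (summable_pow_length (α := α × Bool) (norm_nonneg z) ?_).comp_injective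
    (toWord_injective (α := α))
  simpa [mul_comm] using h

end FreeGroup

theorem Summable.hasSum_card_fiber_mul_pow {β : Type*} (f : β → ℕ) {z : ℂ}
    (h : Summable fun x => z ^ f x) :
    HasSum (fun n => (Nat.card {x // f x = n} : ℂ) * z ^ n) (∑' x, z ^ f x) := by
  have hs := (Equiv.sigmaFiberEquiv f).summable_iff.mpr h
  have hh := ((Equiv.sigmaFiberEquiv f).hasSum_iff.mpr h.hasSum).sigma
    fun n => (hs.sigma_factor n).hasSum
  have key (n : ℕ) (x : {x // f x = n}) : z ^ f x.1 = z ^ n := by rw [x.2]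
  simpa only [Function.comp_apply, Equiv.sigmaFiberEquiv_apply, key, tsum_const, nsmul_eq_mul]
    using hh

namespace FreeGroup

section Walks

variable {α : Type*} [Fintype α] (N : Subgroup (FreeGroup α))

/-- The number of words of length `n` in the letters and their inverses whose product is in `N`. -/
noncomputable def walkCount (n : ℕ) : ℕ :=
  Nat.card {s : Fin n → α × Bool // (List.ofFn fun i => letter (s i)).prod ∈ N}

theorem walkCount_le (n : ℕ) : walkCount N n ≤ (2 * Fintype.card α) ^ n := by
  refine (Nat.card_le_card_of_injective _ Subtype.val_injective).trans ?_
  simp [mul_comm]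

variable [DecidableEq α]

/-- The sum of `z ^ |w x|` over `x ∈ N` and all words `w` of length `n`. -/
noncomputable def walkSum (z : ℂ) (n : ℕ) : ℂ :=
  ∑ s : Fin n → α × Bool, ∑' x : N,
    z ^ norm ((List.ofFn fun i => letter (s i)).prod * (x : FreeGroup α))

variable {N} {z : ℂ}

theorem summable_pow_norm_mul (h : 2 * Fintype.card α * ‖z‖ < 1) (g : FreeGroup α) :
    Summable fun x : N => z ^ norm (g * (x : FreeGroup α)) :=
  (summable_pow_norm h).comp_injective ((mul_right_injective g).comp Subtype.val_injective)

theorem tsum_pow_norm_mul (h : 2 * Fintype.card α * ‖z‖ < 1) (g : FreeGroup α) [Decidable (g ∈ N)] :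
    ((2 * (Fintype.card α : ℂ) - 1) * z ^ 2 + 1) * ∑' x : N, z ^ norm (g * (x : FreeGroup α)) =
      (if g ∈ N then 1 - z ^ 2 else 0) +
        z * ∑ s : α × Bool, ∑' x : N, z ^ norm (letter s * g * (x : FreeGroup α)) := by
  have hdelta : HasSum (fun x : N => if g * (x : FreeGroup α) = 1 then 1 - z ^ 2 else 0)
      (if g ∈ N then 1 - z ^ 2 else 0) := by
    split_ifs with hg
    · convert hasSum_ite_eq (⟨g⁻¹, N.inv_mem hg⟩ : N) (1 - z ^ 2) using 3 with x
      rw [Subtype.ext_iff, mul_eq_one_iff_inv_eq, eq_comm]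
    · convert hasSum_zero with x
      rw [if_neg]
      intro hx
      rw [mul_eq_one_iff_eq_inv.mp hx] at hg
      exact hg (N.inv_mem x.2)
  have hsum := hdelta.add ((hasSum_sum fun (s : α × Bool) (_ : s ∈ Finset.univ) =>
    (summable_pow_norm_mul (N := N) h (letter s * g)).hasSum).mul_left z)
  refine ((summable_pow_norm_mul h g).hasSum.mul_left _).unique ?_
  simpa only [sum_pow_norm_letter_mul, mul_assoc] using hsum

theorem walkSum_succ (h : 2 * Fintype.card α * ‖z‖ < 1) (n : ℕ) :
    ((2 * (Fintype.card α : ℂ) - 1) * z ^ 2 + 1) * walkSum N z n =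
      (1 - z ^ 2) * walkCount N n + z * walkSum N z (n + 1) := by
  classical
  have hcount : (walkCount N n : ℂ) * (1 - z ^ 2) = ∑ s : Fin n → α × Bool,
      if (List.ofFn fun i => letter (s i)).prod ∈ N then 1 - z ^ 2 else 0 := by
    rw [walkCount, Nat.card_eq_fintype_card, Fintype.card_subtype, ← Finset.sum_filter,
      Finset.sum_const, nsmul_eq_mul]
  have hsucc : walkSum N z (n + 1) = ∑ s : Fin n → α × Bool, ∑ a : α × Bool,
      ∑' x : N, z ^ norm (letter a * (List.ofFn fun i => letter (s i)).prod * (x : FreeGroup α)) := by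
    rw [walkSum, ← (Fin.consEquiv fun _ => α × Bool).sum_comp, Fintype.sum_prod_type,
      Finset.sum_comm]
    simp [Fin.consEquiv, List.ofFn_succ]
  rw [hsucc, mul_comm (1 - z ^ 2), hcount, walkSum, Finset.mul_sum, Finset.mul_sum,
    ← Finset.sum_add_distrib]
  exact Finset.sum_congr rfl fun s _ => tsum_pow_norm_mul h _

theorem norm_walkSum_le (h : 2 * Fintype.card α * ‖z‖ < 1) (n : ℕ) :
    ‖walkSum N z n‖ ≤ (2 * Fintype.card α) ^ n * ∑' x : FreeGroup α, ‖z‖ ^ norm x := by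
  have hs : Summable fun x : FreeGroup α => ‖z‖ ^ norm x := by
    simpa using (summable_pow_norm h).norm
  have hle (g : FreeGroup α) : ‖∑' x : N, z ^ norm (g * (x : FreeGroup α))‖ ≤
      ∑' x : FreeGroup α, ‖z‖ ^ norm x := by
    have hinj := (mul_right_injective g).comp (Subtype.val_injective (p := (· ∈ N)))
    refine (norm_tsum_le_tsum_norm (summable_pow_norm_mul h g).norm).trans ?_
    simp only [norm_pow]
    exact (hs.comp_injective hinj).tsum_le_tsum_of_inj _ hinj
      (fun _ _ => by positivity) (fun _ => le_rfl) hs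
  refine (norm_sum_le_of_le _ fun s _ => hle _).trans_eq ?_
  simp [mul_comm]

theorem hasSum_walkCount (h : 2 * Fintype.card α * ‖z‖ < 1) (hz : 1 - z ^ 2 ≠ 0)
    (hD : (2 * (Fintype.card α : ℂ) - 1) * z ^ 2 + 1 ≠ 0)
    (hu : 2 * Fintype.card α * ‖z / ((2 * (Fintype.card α : ℂ) - 1) * z ^ 2 + 1)‖ < 1) :
    HasSum (fun n => (walkCount N n : ℂ) *
        (z / ((2 * (Fintype.card α : ℂ) - 1) * z ^ 2 + 1)) ^ (n + 1))
      (z / (1 - z ^ 2) * ∑' x : N, z ^ norm (x : FreeGroup α)) := by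
  have hstep := walkSum_succ (N := N) h
  set D := (2 * (Fintype.card α : ℂ) - 1) * z ^ 2 + 1
  set u := z / D with hudef
  have hsum : Summable fun n => (walkCount N n : ℂ) * u ^ (n + 1) := by
    refine Summable.of_norm_bounded
      ((summable_geometric_of_lt_one (by positivity) hu).mul_right ‖u‖) fun n => ?_
    rw [norm_mul, norm_pow, Complex.norm_natCast, pow_succ, ← mul_assoc, mul_pow]
    gcongr
    exact_mod_cast walkCount_le N n
  have hpartial (n : ℕ) : ∑ m ∈ Finset.range n, (walkCount N m : ℂ) * u ^ (m + 1) =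
      z / (1 - z ^ 2) * (walkSum N z 0 - u ^ n * walkSum N z n) := by
    induction n with
    | zero => simp
    | succ n ih =>
      have hrec : walkSum N z n = (1 - z ^ 2) / D * walkCount N n + u * walkSum N z (n + 1) := by
        rw [hudef]
        field_simp
        linear_combination hstep n
      have hcancel : z / (1 - z ^ 2) * ((1 - z ^ 2) / D) = u := by
        rw [hudef]
        field_simp
      rw [Finset.sum_range_succ, ih]
      linear_combination (-(z / (1 - z ^ 2)) * u ^ n) * hrec - u ^ n * walkCount N n * hcancel
  have hlim : Tendsto (fun n => u ^ n * walkSum N z n) atTop (𝓝 0) := by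
    refine squeeze_zero_norm (a := fun n => (2 * Fintype.card α * ‖u‖) ^ n *
      ∑' x : FreeGroup α, ‖z‖ ^ norm x) (fun n => ?_) ?_
    · rw [norm_mul, norm_pow, mul_pow, mul_comm _ (‖u‖ ^ n), mul_assoc]
      gcongr
      exact norm_walkSum_le h n
    · simpa using (tendsto_pow_atTop_nhds_zero_of_lt_one (by positivity) hu).mul_const _
  have hzero : walkSum N z 0 = ∑' x : N, z ^ norm (x : FreeGroup α) := by simp [walkSum]
  have hlim' := (hlim.const_sub (walkSum N z 0)).const_mul (z / (1 - z ^ 2))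
  simp only [← hpartial, sub_zero] at hlim'
  rw [← hzero, ← tendsto_nhds_unique hsum.hasSum.tendsto_sum_nat hlim']
  exact hsum.hasSum

end Walks

end FreeGroup


/-- Let `r ≥ 2`, `q = 2r - 1`, `N` a normal subgroup of the free group
on `r` generators, `γ n` the number of elements of `N` of reduced length `n`, and `W n`
the number of `n`-tuples of generators and inverses whose product lies in `N`. Then for
all complex `z` of sufficiently small nonzero modulus,
`(z/(1 - z²))·∑ γ n z^n = ∑ W n (z/(q z² + 1))^(n+1)`, both series converging
absolutely. -/
theorem cogrowth_generating_function_identity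
    (r : ℕ) (hr : 2 ≤ r)
    (N : Subgroup (FreeGroup (Fin r))) (hNnormal : N.Normal)
    (γ : ℕ → ℕ)
    (hγ : ∀ n, γ n = Nat.card {x : FreeGroup (Fin r) // x ∈ N ∧ FreeGroup.norm x = n})
    (W : ℕ → ℕ)
    (hW : ∀ n, W n = Nat.card {s : Fin n → Fin r × Bool //
      (List.ofFn (fun i => if (s i).2 then FreeGroup.of (s i).1
        else (FreeGroup.of (s i).1)⁻¹)).prod ∈ N}) :
    ∃ ε > 0, ∀ z : ℂ, z ≠ 0 → ‖z‖ < ε →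
      Summable (fun n : ℕ => (γ n : ℂ) * z ^ n) ∧
      Summable (fun n : ℕ =>
        (W n : ℂ) * (z / ((2 * (r : ℂ) - 1) * z ^ 2 + 1)) ^ (n + 1)) ∧
      (z / (1 - z ^ 2)) * ∑' n : ℕ, (γ n : ℂ) * z ^ n =
        ∑' n : ℕ, (W n : ℂ) * (z / ((2 * (r : ℂ) - 1) * z ^ 2 + 1)) ^ (n + 1) := by
  have hr0 : (2 : ℝ) ≤ r := by exact_mod_cast hr
  refine ⟨1 / (4 * r), by positivity, fun z _ hzε => ?_⟩
  have hz4 : 4 * r * ‖z‖ < 1 := by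
    rw [lt_div_iff₀ (by positivity)] at hzε
    linarith
  have hz8 : ‖z‖ < 1 / 8 := by nlinarith [norm_nonneg z]
  have hz : 1 - z ^ 2 ≠ 0 := by
    intro h
    have h1 : ‖z‖ ^ 2 = 1 := by rw [← norm_pow, ← sub_eq_zero.mp h, norm_one]
    nlinarith [norm_nonneg z]
  have hD : 1 / 2 < ‖(2 * (r : ℂ) - 1) * z ^ 2 + 1‖ := by
    have h1 : ‖(2 * (r : ℂ) - 1)‖ ≤ 4 * r := by
      refine (norm_sub_le _ _).trans ?_
      simp
      linarith
    have h2 : ‖(2 * (r : ℂ) - 1) * z ^ 2‖ ≤ 1 / 8 := by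
      rw [norm_mul, norm_pow]
      nlinarith [norm_nonneg z, mul_le_mul_of_nonneg_right h1 (sq_nonneg ‖z‖)]
    have h3 := norm_sub_le_norm_add (1 : ℂ) ((2 * (r : ℂ) - 1) * z ^ 2)
    rw [norm_one, add_comm (1 : ℂ)] at h3
    linarith
  have h : 2 * Fintype.card (Fin r) * ‖z‖ < 1 := by
    rw [Fintype.card_fin]
    nlinarith [norm_nonneg z]
  have hW' := FreeGroup.hasSum_walkCount (N := N) h hz
    (by rw [Fintype.card_fin]; exact norm_pos_iff.mp (by linarith))
    (by
      rw [Fintype.card_fin, norm_div, ← mul_div_assoc, div_lt_one (by linarith)]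
      linarith)
  have hγ' : HasSum (fun n => (γ n : ℂ) * z ^ n)
      (∑' x : N, z ^ FreeGroup.norm (x : FreeGroup (Fin r))) := by
    convert Summable.hasSum_card_fiber_mul_pow
      (fun x : N => FreeGroup.norm (x : FreeGroup (Fin r)))
      (by simpa using FreeGroup.summable_pow_norm_mul (N := N) h 1) using 4 with n
    rw [hγ]
    exact Nat.card_congr (Equiv.subtypeSubtypeEquivSubtypeInter (· ∈ N) _).symm
  have hWeq : W = FreeGroup.walkCount N := funext hW
  rw [Fintype.card_fin, ← hWeq] at hW'
  exact ⟨hγ'.summable, hW'.summable, by rw [hγ'.tsum_eq, hW'.tsum_eq]⟩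
end

section
/- Let q > 1, ρ > 1, set ρ₀ = (1 + ρ)/2, and let ν be a Borel measure on [0, ρ] of total mass at most 1 whose topological support contains ρ. Set I_n = ∫_0^ρ ( U_{2n}(x) − q^{-1} U_{2n−2}(x) ) dν(x), M_n = ∫_0^ρ x^n dν(x), and h(ρ₀) = ((ρ₀ + √(ρ₀² − 1))² − q^{-1}) / (2√(ρ₀² − 1)·(ρ₀ + √(ρ₀² − 1))). Then limsup_{n→∞} [ I_n · ρ^{2n} / ( (ρ + √(ρ² − 1))^{2n} · M_{2n} ) ] ≤ h(ρ₀). -/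
open Filter MeasureTheory

open Polynomial.Chebyshev in
theorem abs_eval_U_le_s18 {x w : ℝ} (hx : |x| ≤ w)
    (hT : ∀ n : ℕ, |(T ℝ (n : ℤ)).eval x| ≤ w ^ n) (n : ℕ) :
    |(U ℝ (n : ℤ)).eval x| ≤ (n + 1) * w ^ n := by
  induction n with
  | zero => simp
  | succ k ih =>
    have hU : (U ℝ ((k + 1 : ℕ) : ℤ)).eval x =
        x * (U ℝ (k : ℤ)).eval x + (T ℝ ((k + 1 : ℕ) : ℤ)).eval x := by
      push_cast
      rw [U_eq_X_mul_U_add_T]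
      simp
    have h1 : |x * (U ℝ (k : ℤ)).eval x| ≤ w * ((k + 1) * w ^ k) := by
      rw [abs_mul]
      exact mul_le_mul hx ih (abs_nonneg _) ((abs_nonneg _).trans hx)
    rw [hU]
    refine (abs_add_le _ _).trans ((add_le_add h1 (hT (k + 1))).trans_eq ?_)
    push_cast
    ring

open Polynomial.Chebyshev in
theorem eval_T_joukowsky {x z : ℝ} (hz : z ≠ 0) (hx : 2 * x = z + z⁻¹) (n : ℕ) :
    2 * (T ℝ (n : ℤ)).eval x = z ^ n + z⁻¹ ^ n := by
  induction n using Nat.twoStepInduction with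
  | zero => norm_num
  | one => simpa using hx
  | more k h0 h1 =>
    have h : 2 * (T ℝ ((k + 2 : ℕ) : ℤ)).eval x =
        2 * x * (2 * (T ℝ ((k + 1 : ℕ) : ℤ)).eval x) - 2 * (T ℝ (k : ℤ)).eval x := by
      push_cast
      rw [T_add_two]
      simp
      ring
    rw [h, h0, h1, hx]
    linear_combination (z ^ k + z⁻¹ ^ k) * mul_inv_cancel₀ hz

open Polynomial.Chebyshev in
theorem eval_U_joukowsky {x z : ℝ} (hz : z ≠ 0) (hx : 2 * x = z + z⁻¹) (n : ℕ) :
    (U ℝ (n : ℤ)).eval x * (z ^ 2 - 1) = z ^ (n + 2) - z⁻¹ ^ n := by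
  induction n using Nat.twoStepInduction with
  | zero => simp
  | one =>
    simp only [Nat.cast_one, U_one, Polynomial.eval_mul, Polynomial.eval_ofNat,
      Polynomial.eval_X, hx]
    field_simp
    ring
  | more k h0 h1 =>
    have h : (U ℝ ((k + 2 : ℕ) : ℤ)).eval x * (z ^ 2 - 1) =
        2 * x * ((U ℝ ((k + 1 : ℕ) : ℤ)).eval x * (z ^ 2 - 1)) -
          (U ℝ (k : ℤ)).eval x * (z ^ 2 - 1) := by
      push_cast
      rw [U_add_two]
      simp
      ring
    rw [h, h0, h1, hx]
    linear_combination (z ^ (k + 2) - z⁻¹ ^ k) * mul_inv_cancel₀ hz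

/-- The larger root `z` of `z + z⁻¹ = 2 * x`, for `1 ≤ x`. -/
noncomputable def joukowskyInv (x : ℝ) : ℝ := x + Real.sqrt (x ^ 2 - 1)

theorem le_joukowskyInv (x : ℝ) : x ≤ joukowskyInv x :=
  le_add_of_nonneg_right (Real.sqrt_nonneg _)

theorem two_mul_eq_joukowskyInv_add_inv {x : ℝ} (hx : 1 ≤ x) :
    2 * x = joukowskyInv x + (joukowskyInv x)⁻¹ := by
  have hz : joukowskyInv x ≠ 0 := by linarith [le_joukowskyInv x]
  have hs := Real.sq_sqrt (show 0 ≤ x ^ 2 - 1 by nlinarith)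
  field_simp
  unfold joukowskyInv
  linear_combination -hs

theorem joukowskyInv_mono {x y : ℝ} (hx : 1 ≤ x) (hxy : x ≤ y) :
    joukowskyInv x ≤ joukowskyInv y := by
  unfold joukowskyInv
  gcongr

theorem joukowskyInv_mul_le {x y : ℝ} (hx : 1 ≤ x) (hxy : x ≤ y) :
    joukowskyInv x * y ≤ joukowskyInv y * x := by
  have hsx := Real.sq_sqrt (show 0 ≤ x ^ 2 - 1 by nlinarith)
  have hsy := Real.sq_sqrt (show 0 ≤ y ^ 2 - 1 by nlinarith)
  have h : Real.sqrt (x ^ 2 - 1) * y ≤ Real.sqrt (y ^ 2 - 1) * x := by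
    refine le_of_sq_le_sq ?_ (by positivity)
    rw [mul_pow, mul_pow, hsx, hsy]
    nlinarith
  unfold joukowskyInv
  linarith

theorem joukowskyInv_mul_lt {x y : ℝ} (hx : 1 ≤ x) (hxy : x < y) :
    joukowskyInv x * y < joukowskyInv y * x := by
  have hsx := Real.sq_sqrt (show 0 ≤ x ^ 2 - 1 by nlinarith)
  have hsy := Real.sq_sqrt (show 0 ≤ y ^ 2 - 1 by nlinarith)
  have h : Real.sqrt (x ^ 2 - 1) * y < Real.sqrt (y ^ 2 - 1) * x := by
    refine lt_of_pow_lt_pow_left₀ 2 (by positivity) ?_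
    rw [mul_pow, mul_pow, hsx, hsy]
    nlinarith
  unfold joukowskyInv
  linarith

open Polynomial.Chebyshev in
theorem abs_eval_U_le_joukowskyInv {x b : ℝ} (hb : 1 ≤ b) (hx0 : 0 ≤ x) (hxb : x ≤ b) (n : ℕ) :
    |(U ℝ (n : ℤ)).eval x| ≤ (n + 1) * joukowskyInv b ^ n := by
  have hw := le_joukowskyInv b
  refine abs_eval_U_le_s18 (by rw [abs_of_nonneg hx0]; linarith) (fun k ↦ ?_) n
  rcases le_total x 1 with hx1 | hx1
  · exact (abs_eval_T_real_le_one k (by rwa [abs_of_nonneg hx0])).trans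
      (one_le_pow₀ (hb.trans hw))
  · have hz : 1 ≤ joukowskyInv x := hx1.trans (le_joukowskyInv x)
    have hT := eval_T_joukowsky (by positivity) (two_mul_eq_joukowskyInv_add_inv hx1) k
    have h1 : (joukowskyInv x)⁻¹ ^ k ≤ 1 := pow_le_one₀ (by positivity) (inv_le_one_of_one_le₀ hz)
    have h2 : 1 ≤ joukowskyInv x ^ k := one_le_pow₀ hz
    have h3 : joukowskyInv x ^ k ≤ joukowskyInv b ^ k :=
      pow_le_pow_left₀ (by positivity) (joukowskyInv_mono hx1 hxb) k
    have h4 : 0 < (joukowskyInv x)⁻¹ ^ k := by positivity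
    rw [abs_of_nonneg (by linarith)]
    linarith

open Polynomial.Chebyshev in
theorem eval_U_sub_le_joukowsky {p x z : ℝ} (hp : p ≤ 1) (hz : 1 < z)
    (hx : 2 * x = z + z⁻¹) (m : ℕ) :
    (U ℝ ((2 * m + 2 : ℕ) : ℤ)).eval x - p * (U ℝ ((2 * m : ℕ) : ℤ)).eval x ≤
      (z ^ 2 - p) / (z ^ 2 - 1) * z ^ (2 * m + 2) + 1 := by
  have hz0 : 0 < z := by linarith
  have hd : 0 < z ^ 2 - 1 := by nlinarith
  have h1 := eval_U_joukowsky hz0.ne' hx (2 * m + 2)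
  have h2 := eval_U_joukowsky hz0.ne' hx (2 * m)
  have ha1 : (z⁻¹) ^ (2 * m) ≤ 1 :=
    pow_le_one₀ (by positivity) (inv_le_one_of_one_le₀ hz.le)
  have ha0 : 0 < (z⁻¹) ^ (2 * m) := by positivity
  have hi1 : z⁻¹ ^ 2 ≤ 1 := pow_le_one₀ (by positivity) (inv_le_one_of_one_le₀ hz.le)
  have hi : z⁻¹ ^ 2 * z ^ 2 = 1 := by field_simp
  have hrem : z⁻¹ ^ (2 * m) * (p - z⁻¹ ^ 2) ≤ z ^ 2 - 1 := by
    have : 1 - z⁻¹ ^ 2 ≤ z ^ 2 - 1 := by nlinarith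
    nlinarith
  refine le_of_mul_le_mul_right ?_ hd
  have e : ((z ^ 2 - p) / (z ^ 2 - 1) * z ^ (2 * m + 2) + 1) * (z ^ 2 - 1) =
      (z ^ 2 - p) * z ^ (2 * m + 2) + (z ^ 2 - 1) := by
    field_simp
  rw [e, sub_mul, h1, mul_assoc, h2]
  have e1 : z⁻¹ ^ (2 * m + 2) = z⁻¹ ^ (2 * m) * z⁻¹ ^ 2 := pow_add _ _ _
  rw [e1]
  have e2 : z ^ (2 * m + 2 + 2) = z ^ 2 * z ^ (2 * m + 2) := by ring
  rw [e2]
  linarith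

open Polynomial.Chebyshev in
theorem eval_U_sub_le {p b c x : ℝ} (hp0 : 0 ≤ p) (hp : p ≤ 1) (hb : 1 < b) (hbc : b ≤ c)
    (hx0 : 0 ≤ x) (hxc : x ≤ c) (m : ℕ) :
    (U ℝ ((2 * m + 2 : ℕ) : ℤ)).eval x - p * (U ℝ ((2 * m : ℕ) : ℤ)).eval x ≤
      (joukowskyInv b ^ 2 - p) / (joukowskyInv b ^ 2 - 1) *
        ((joukowskyInv c / c) ^ (2 * m + 2) * x ^ (2 * m + 2)) +
      (4 * m + 4) * joukowskyInv b ^ (2 * m + 2) := by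
  have hw : 1 < joukowskyInv b := hb.trans_le (le_joukowskyInv b)
  have hwd : 0 < joukowskyInv b ^ 2 - 1 := by nlinarith
  have hc : 0 < c := by linarith
  have hcJ := le_joukowskyInv c
  have hcJ0 : 0 ≤ joukowskyInv c := by linarith
  have hH : 0 ≤ (joukowskyInv b ^ 2 - p) / (joukowskyInv b ^ 2 - 1) :=
    div_nonneg (by linarith) hwd.le
  have hpow : 1 ≤ joukowskyInv b ^ (2 * m + 2) := one_le_pow₀ hw.le
  rcases le_total x b with hxb | hxb
  · have h1 := abs_le.1 (abs_eval_U_le_joukowskyInv hb.le hx0 hxb (2 * m + 2))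
    have h2 := abs_eval_U_le_joukowskyInv hb.le hx0 hxb (2 * m)
    have h3 : joukowskyInv b ^ (2 * m) ≤ joukowskyInv b ^ (2 * m + 2) :=
      pow_le_pow_right₀ hw.le (by omega)
    have h4 : -(p * (U ℝ ((2 * m : ℕ) : ℤ)).eval x) ≤
        (2 * m + 1) * joukowskyInv b ^ (2 * m + 2) := by
      calc -(p * (U ℝ ((2 * m : ℕ) : ℤ)).eval x)
          ≤ |p * (U ℝ ((2 * m : ℕ) : ℤ)).eval x| := neg_le_abs _
        _ = p * |(U ℝ ((2 * m : ℕ) : ℤ)).eval x| := by rw [abs_mul, abs_of_nonneg hp0]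
        _ ≤ 1 * |(U ℝ ((2 * m : ℕ) : ℤ)).eval x| := by gcongr
        _ ≤ (2 * m + 1) * joukowskyInv b ^ (2 * m) := by
          rw [one_mul]; exact_mod_cast h2
        _ ≤ _ := by gcongr
    have h5 := h1.2
    push_cast at h4 h5 ⊢
    have : 0 ≤ (joukowskyInv b ^ 2 - p) / (joukowskyInv b ^ 2 - 1) *
        ((joukowskyInv c / c) ^ (2 * m + 2) * x ^ (2 * m + 2)) := by positivity
    linarith
  · have hx1 : 1 < x := hb.trans_le hxb
    have hz : 1 < joukowskyInv x := hx1.trans_le (le_joukowskyInv x)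
    have hzw := joukowskyInv_mono hb.le hxb
    refine (eval_U_sub_le_joukowsky hp hz (two_mul_eq_joukowskyInv_add_inv hx1.le) m).trans
      (add_le_add (mul_le_mul ?_ ?_ (by positivity) hH) ?_)
    · have hsq : joukowskyInv b ^ 2 ≤ joukowskyInv x ^ 2 :=
        pow_le_pow_left₀ (by positivity) hzw 2
      rw [div_le_div_iff₀ (by linarith) hwd]
      nlinarith
    · rw [← mul_pow]
      refine pow_le_pow_left₀ (by positivity) ?_ _
      rw [div_mul_eq_mul_div, le_div_iff₀ hc]
      exact joukowskyInv_mul_le hx1.le hxc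
    · have : (0 : ℝ) ≤ m := Nat.cast_nonneg m
      nlinarith

theorem limsup_le_of_forall_pos_eventually_le {u : ℕ → ℝ} {h : ℝ} (hh : 0 ≤ h)
    (hu : ∀ ε > 0, ∀ᶠ n in atTop, u n ≤ h + ε) : limsup u atTop ≤ h := by
  rw [limsup_eq]
  by_cases hb : BddBelow {a | ∀ᶠ n in atTop, u n ≤ a}
  · exact le_of_forall_pos_le_add fun ε hε ↦ csInf_le hb (hu ε hε)
  · rwa [Real.sInf_of_not_bddBelow hb]

theorem integrable_of_continuous_of_ae_mem_Icc {ν : Measure ℝ} [IsFiniteMeasure ν] {a b : ℝ}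
    (hν : ∀ᵐ x ∂ν, x ∈ Set.Icc a b) {f : ℝ → ℝ} (hf : Continuous f) : Integrable f ν := by
  have h := hf.continuousOn.integrableOn_compact (μ := ν) (isCompact_Icc (a := a) (b := b))
  rwa [IntegrableOn, Measure.restrict_eq_self_of_ae_mem hν] at h

/-- Let `q > 1`, `ρ > 1`, `ρ₀ = (1 + ρ)/2` and let `ν` be a Borel
measure on `[0, ρ]` of total mass at most `1` whose topological support contains `ρ`.
With `I n = ∫ (U (2n) x - q⁻¹ U (2n-2) x) dν`, `M n = ∫ x^n dν` and
`h = ((ρ₀ + √(ρ₀² - 1))² - q⁻¹) / (2√(ρ₀² - 1)·(ρ₀ + √(ρ₀² - 1)))`, one has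
`limsup I n · ρ^(2n) / ((ρ + √(ρ² - 1))^(2n) · M (2n)) ≤ h`. -/
theorem chebyshev_integral_limsup_le
    (q : ℝ) (hq : 1 < q) (ρ : ℝ) (hρ : 1 < ρ) (ρ₀ : ℝ) (hρ₀ : ρ₀ = (1 + ρ) / 2)
    (ν : Measure ℝ) (hν : ν (Set.Icc 0 ρ)ᶜ = 0) (hν1 : ν Set.univ ≤ 1)
    (hsupp : ∀ U ∈ nhds ρ, 0 < ν U)
    (I : ℕ → ℝ)
    (hI : ∀ n, I n = ∫ x in Set.Icc 0 ρ,
      ((Polynomial.Chebyshev.U ℝ (2 * (n : ℤ))).eval x -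
        q⁻¹ * (Polynomial.Chebyshev.U ℝ (2 * (n : ℤ) - 2)).eval x) ∂ν)
    (M : ℕ → ℝ)
    (hM : ∀ n, M n = ∫ x in Set.Icc 0 ρ, x ^ n ∂ν)
    (h : ℝ)
    (hh : h = ((ρ₀ + Real.sqrt (ρ₀ ^ 2 - 1)) ^ 2 - q⁻¹) /
      (2 * Real.sqrt (ρ₀ ^ 2 - 1) * (ρ₀ + Real.sqrt (ρ₀ ^ 2 - 1)))) :
    limsup
      (fun n : ℕ =>
        I n * ρ ^ (2 * n) / ((ρ + Real.sqrt (ρ ^ 2 - 1)) ^ (2 * n) * M (2 * n)))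
      atTop ≤ h := by
  have hfin : IsFiniteMeasure ν := ⟨hν1.trans_lt ENNReal.one_lt_top⟩
  have hae : ∀ᵐ x ∂ν, x ∈ Set.Icc 0 ρ := hν
  rw [Measure.restrict_eq_self_of_ae_mem hae] at hI hM
  have hb : 1 < ρ₀ := by linarith
  have hbc : ρ₀ < ρ := by linarith
  have hw : 1 < joukowskyInv ρ₀ := hb.trans_le (le_joukowskyInv _)
  have hW : 1 < joukowskyInv ρ := hρ.trans_le (le_joukowskyInv _)
  have hwd : 0 < joukowskyInv ρ₀ ^ 2 - 1 := by nlinarith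
  have hp0 : 0 ≤ q⁻¹ := by positivity
  have hp1 : q⁻¹ ≤ 1 := inv_le_one_of_one_le₀ hq.le
  have hh' : h = (joukowskyInv ρ₀ ^ 2 - q⁻¹) / (joukowskyInv ρ₀ ^ 2 - 1) := by
    have hs := Real.sq_sqrt (show 0 ≤ ρ₀ ^ 2 - 1 by nlinarith)
    rw [hh]
    unfold joukowskyInv
    congr 1
    linear_combination hs
  have hh0 : 0 ≤ h := by
    rw [hh']
    exact div_nonneg (by linarith) hwd.le
  have hνr : ν.real Set.univ ≤ 1 := by
    rw [measureReal_def]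
    exact ENNReal.toReal_le_of_le_ofReal zero_le_one (by simpa using hν1)
  have hc : 0 < ν.real (Set.Ioi ρ₀) :=
    ENNReal.toReal_pos (hsupp _ (Ioi_mem_nhds hbc)).ne' (measure_ne_top _ _)
  set c := ν.real (Set.Ioi ρ₀)
  have hMle : ∀ n, ρ₀ ^ n * c ≤ M n := fun n ↦ by
    have h1 : ∫ x, (Set.Ioi ρ₀).indicator (fun _ ↦ ρ₀ ^ n) x ∂ν = ρ₀ ^ n * c := by
      rw [integral_indicator_const _ measurableSet_Ioi, smul_eq_mul, mul_comm]
    rw [hM, ← h1]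
    refine integral_mono_ae ((integrable_const _).indicator measurableSet_Ioi)
      (integrable_of_continuous_of_ae_mem_Icc hae (continuous_pow n)) ?_
    filter_upwards [hae] with x hx
    by_cases hx' : x ∈ Set.Ioi ρ₀
    · rw [Set.indicator_of_mem hx']
      exact pow_le_pow_left₀ (by linarith) (Set.mem_Ioi.1 hx').le n
    · rw [Set.indicator_of_notMem hx']
      exact pow_nonneg hx.1 n
  have hIle : ∀ m : ℕ, I (m + 1) ≤ h * ((joukowskyInv ρ / ρ) ^ (2 * (m + 1)) * M (2 * (m + 1))) +
      (4 * m + 4) * joukowskyInv ρ₀ ^ (2 * (m + 1)) := fun m ↦ by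
    have e1 : 2 * ((m + 1 : ℕ) : ℤ) = ((2 * m + 2 : ℕ) : ℤ) := by push_cast; ring
    have e2 : 2 * ((m + 1 : ℕ) : ℤ) - 2 = ((2 * m : ℕ) : ℤ) := by push_cast; ring
    have hi1 := (integrable_of_continuous_of_ae_mem_Icc hae (continuous_pow (2 * m + 2))).const_mul
      ((joukowskyInv ρ / ρ) ^ (2 * m + 2)) |>.const_mul h
    rw [hI, e2, e1, hM, show 2 * (m + 1) = 2 * m + 2 by ring]
    calc _ ≤ ∫ x, (h * ((joukowskyInv ρ / ρ) ^ (2 * m + 2) * x ^ (2 * m + 2)) +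
          (4 * m + 4) * joukowskyInv ρ₀ ^ (2 * m + 2)) ∂ν := by
          refine integral_mono_ae (integrable_of_continuous_of_ae_mem_Icc hae (by fun_prop))
            (hi1.add (integrable_const _)) ?_
          filter_upwards [hae] with x hx
          rw [hh']
          exact eval_U_sub_le hp0 hp1 hb hbc.le hx.1 hx.2 m
      _ = h * ((joukowskyInv ρ / ρ) ^ (2 * m + 2) * ∫ x, x ^ (2 * m + 2) ∂ν) +
          ν.real Set.univ * ((4 * m + 4) * joukowskyInv ρ₀ ^ (2 * m + 2)) := by
          rw [integral_add hi1 (integrable_const _), integral_const_mul, integral_const_mul,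
            integral_const, smul_eq_mul]
      _ ≤ _ := by
          exact add_le_add le_rfl (mul_le_of_le_one_left (by positivity) hνr)
  set r := joukowskyInv ρ₀ * ρ / (joukowskyInv ρ * ρ₀) with hr
  have hr0 : 0 ≤ r := by positivity
  have hr1 : r < 1 := by
    rw [hr, div_lt_one (by positivity)]
    exact joukowskyInv_mul_lt hb.le hbc
  have hlim : Tendsto (fun n : ℕ ↦ 4 / c * (n * (r ^ 2) ^ n)) atTop (nhds 0) := by
    simpa using (tendsto_self_mul_const_pow_of_lt_one (sq_nonneg r)
      (pow_lt_one₀ hr0 hr1 two_ne_zero)).const_mul (4 / c)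
  refine limsup_le_of_forall_pos_eventually_le hh0 fun ε hε ↦ ?_
  filter_upwards [hlim.eventually_le_const hε, eventually_ge_atTop 1] with n hn hn1
  obtain ⟨m, rfl⟩ : ∃ m, n = m + 1 := ⟨n - 1, by omega⟩
  refine le_trans ?_ (add_le_add_right hn h)
  change _ / (joukowskyInv ρ ^ _ * _) ≤ _
  set k := 2 * (m + 1) with hk
  have hMk := hMle k
  have hMpos : 0 < M k := lt_of_lt_of_le (by positivity) hMk
  have hWk : 0 < joukowskyInv ρ ^ k := by positivity
  calc I (m + 1) * ρ ^ k / (joukowskyInv ρ ^ k * M k)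
      ≤ (h * ((joukowskyInv ρ / ρ) ^ k * M k) + (4 * m + 4) * joukowskyInv ρ₀ ^ k) * ρ ^ k /
        (joukowskyInv ρ ^ k * M k) := by
        gcongr
        exact hIle m
    _ = h + (4 * m + 4) * joukowskyInv ρ₀ ^ k * ρ ^ k / (joukowskyInv ρ ^ k * M k) := by
        rw [div_pow]
        field_simp
    _ ≤ h + (4 * m + 4) * joukowskyInv ρ₀ ^ k * ρ ^ k / (joukowskyInv ρ ^ k * (ρ₀ ^ k * c)) := by
        gcongr
    _ = h + 4 / c * (((m + 1 : ℕ) : ℝ) * (r ^ 2) ^ (m + 1)) := by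
        rw [← pow_mul, ← hk, hr, div_pow, mul_pow, mul_pow]
        push_cast
        field_simp
end

section
/- Let q > 1, ρ > 1, set ρ₀ = (1 + ρ)/2, and let ν be a finite Borel measure on [0, ρ] whose topological support contains ρ. Set I_n = ∫_0^ρ ( U_{2n}(x) − q^{-1} U_{2n−2}(x) ) dν(x) and Ĩ_n = ∫_{ρ₀}^ρ (x + √(x² − 1))^{2n} · ((x + √(x² − 1))² − q^{-1}) / (2√(x² − 1)·(x + √(x² − 1))) dν(x). Then Ĩ_n → ∞ and I_n / Ĩ_n → 1 as n → ∞. -/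
open Filter MeasureTheory

open Polynomial.Chebyshev

/-- Growth bound for the Chebyshev polynomials of the first kind on `[-1, y]`. -/
theorem abs_eval_T_le_exp_arcosh_pow (n : ℕ) {x y : ℝ} (hx : -1 ≤ x) (hxy : x ≤ y)
    (hy : 1 ≤ y) : |(T ℝ n).eval x| ≤ Real.exp (Real.arcosh y) ^ n := by
  have hy0 := Real.arcosh_nonneg hy
  rcases le_total x 1 with h | h
  · exact (abs_eval_T_real_le_one n (abs_le.2 ⟨hx, h⟩)).trans
      (one_le_pow₀ (Real.one_le_exp hy0))
  · have hx0 := Real.arcosh_nonneg h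
    have hle : Real.arcosh x ≤ Real.arcosh y :=
      (Real.arcosh_le_arcosh (by linarith) (by linarith)).2 hxy
    have key := T_real_cosh (Real.arcosh x) n
    rw [Real.cosh_arcosh h] at key
    rw [key, abs_of_pos (Real.cosh_pos _), ← Real.exp_nat_mul, Int.cast_natCast]
    have h0 : 0 ≤ (n : ℝ) * Real.arcosh x := by positivity
    have h1 : Real.cosh (n * Real.arcosh x) ≤ Real.exp (n * Real.arcosh x) := by
      rw [← Real.cosh_add_sinh]
      linarith [Real.sinh_nonneg_iff.2 h0]
    exact h1.trans (Real.exp_le_exp.2 (by gcongr))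

/-- Growth bound for the Chebyshev polynomials of the second kind on `[-1, y]`. -/
theorem abs_eval_U_le_mul_exp_arcosh_pow (n : ℕ) {x y : ℝ} (hx : -1 ≤ x) (hxy : x ≤ y)
    (hy : 1 ≤ y) : |(U ℝ n).eval x| ≤ (n + 1) * Real.exp (Real.arcosh y) ^ n := by
  induction n with
  | zero => simp
  | succ k ih =>
    have hT := abs_eval_T_le_exp_arcosh_pow (k + 1) hx hxy hy
    have hyt : |x| ≤ Real.exp (Real.arcosh y) := by
      rw [Real.exp_arcosh hy]
      exact (abs_le.2 ⟨by linarith, hxy⟩).trans (le_add_of_nonneg_right (Real.sqrt_nonneg _))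
    push_cast at hT ⊢
    rw [U_eq_X_mul_U_add_T]
    simp only [Polynomial.eval_add, Polynomial.eval_mul, Polynomial.eval_X]
    calc _ ≤ |x| * |(U ℝ k).eval x| + |(T ℝ (k + 1)).eval x| := by
          rw [← abs_mul]; exact abs_add_le _ _
      _ ≤ Real.exp (Real.arcosh y) * ((k + 1) * Real.exp (Real.arcosh y) ^ k)
          + Real.exp (Real.arcosh y) ^ (k + 1) := by gcongr
      _ = _ := by ring

/-- The contribution of the decaying exponentials in the Binet-type formula for `U`. -/
theorem abs_eval_U_sub_le_inv_sqrt (n : ℕ) {a x : ℝ} (ha0 : 0 ≤ a) (ha1 : a ≤ 1)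
    (hx : 1 < x) :
    |((U ℝ (2 * ((n + 1 : ℕ) : ℤ))).eval x - a * (U ℝ (2 * ((n + 1 : ℕ) : ℤ) - 2)).eval x) -
      (x + √(x ^ 2 - 1)) ^ (2 * (n + 1)) *
        (((x + √(x ^ 2 - 1)) ^ 2 - a) / (2 * √(x ^ 2 - 1) * (x + √(x ^ 2 - 1))))| ≤
      1 / (2 * √(x ^ 2 - 1)) := by
  have hθ := Real.arcosh_pos hx
  rw [← Real.exp_arcosh hx.le, ← Real.sinh_arcosh hx.le]
  set θ := Real.arcosh x with hθdef
  have hs : 0 < Real.sinh θ := Real.sinh_pos_iff.2 hθ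
  have e1 := U_real_cosh θ (2 * ((n + 1 : ℕ) : ℤ))
  have e2 := U_real_cosh θ (2 * ((n + 1 : ℕ) : ℤ) - 2)
  rw [hθdef, Real.cosh_arcosh hx.le, ← hθdef] at e1 e2
  rw [← eq_div_iff hs.ne'] at e1 e2
  rw [e1, e2, Real.sinh_eq ((_ + 1) * θ), Real.sinh_eq ((_ + 1) * θ)]
  push_cast
  have p1 : Real.exp ((2 * ((n : ℝ) + 1) + 1) * θ) = Real.exp θ ^ (2 * n + 3) := by
    rw [← Real.exp_nat_mul]; push_cast; ring_nf
  have p2 : Real.exp ((2 * ((n : ℝ) + 1) - 2 + 1) * θ) = Real.exp θ ^ (2 * n + 1) := by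
    rw [← Real.exp_nat_mul]; push_cast; ring_nf
  rw [Real.exp_neg ((2 * ((n : ℝ) + 1) + 1) * θ),
    Real.exp_neg ((2 * ((n : ℝ) + 1) - 2 + 1) * θ), p1, p2]
  have ht : 1 ≤ Real.exp θ := Real.one_le_exp hθ.le
  set t := Real.exp θ
  set s := Real.sinh θ
  have hu1 : (t ^ (2 * n + 3))⁻¹ ≤ 1 := inv_le_one_of_one_le₀ (one_le_pow₀ ht)
  have hv1 : (t ^ (2 * n + 1))⁻¹ ≤ 1 := inv_le_one_of_one_le₀ (one_le_pow₀ ht)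
  have hu0 : 0 ≤ (t ^ (2 * n + 3))⁻¹ := by positivity
  have hv0 : 0 ≤ (t ^ (2 * n + 1))⁻¹ := by positivity
  set u := (t ^ (2 * n + 3))⁻¹
  set v := (t ^ (2 * n + 1))⁻¹
  have ht0 : t ≠ 0 := by positivity
  have hs0 := hs.ne'
  have : (t ^ (2 * n + 3) - u) / 2 / s - a * ((t ^ (2 * n + 1) - v) / 2 / s) -
      t ^ (2 * (n + 1)) * ((t ^ 2 - a) / (2 * s * t)) = (a * v - u) / (2 * s) := by
    clear_value u v
    field_simp
    ring
  rw [this, abs_div, abs_of_pos (by positivity : 0 < 2 * s)]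
  gcongr
  rw [abs_le]
  constructor <;> nlinarith [mul_nonneg ha0 hv0, mul_nonneg ha0 (sub_nonneg.2 hv1)]

/-- A sequence dominated by `n * b ^ (2 * n)` is negligible against `c ^ (2 * n)` for `b < c`. -/
theorem tendsto_linear_mul_pow_add_div_pow {b c : ℝ} (hb : 1 ≤ b) (hbc : b < c) (A B : ℝ) :
    Tendsto (fun n : ℕ => (A * ((2 * n + 1) * b ^ (2 * n)) + B) / c ^ (2 * n)) atTop
      (nhds 0) := by
  have hc : 0 < c := by linarith
  have hr1 : (b / c) ^ 2 < 1 :=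
    pow_lt_one₀ (by positivity) ((div_lt_one hc).2 hbc) two_ne_zero
  have hw1 : (1 / c) ^ 2 < 1 :=
    pow_lt_one₀ (by positivity) ((div_lt_one hc).2 (by linarith)) two_ne_zero
  have h1 := (tendsto_self_mul_const_pow_of_lt_one (sq_nonneg (b / c)) hr1).const_mul (2 * A)
  have h2 := (tendsto_pow_atTop_nhds_zero_of_lt_one (sq_nonneg (b / c)) hr1).const_mul A
  have h3 := (tendsto_pow_atTop_nhds_zero_of_lt_one (sq_nonneg (1 / c)) hw1).const_mul B
  have h := (h1.add h2).add h3
  simp only [mul_zero, add_zero] at h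
  refine h.congr fun n => ?_
  rw [← pow_mul, ← pow_mul, div_pow, div_pow, one_pow]
  field_simp

/-- If the difference of two sequences is negligible against a lower bound of the second one,
their ratio tends to `1`. -/
theorem tendsto_div_one_of_abs_sub_le {I J E L : ℕ → ℝ} (hL : ∀ n, 0 < L n)
    (hJ : ∀ n, L n ≤ J n) (hE : ∀ᶠ n in atTop, |I n - J n| ≤ E n)
    (h : Tendsto (fun n => E n / L n) atTop (nhds 0)) :
    Tendsto (fun n => I n / J n) atTop (nhds 1) := by
  rw [tendsto_iff_norm_sub_tendsto_zero]
  refine squeeze_zero' (Eventually.of_forall fun _ => norm_nonneg _) ?_ h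
  filter_upwards [hE] with n hn
  have hJpos : 0 < J n := (hL n).trans_le (hJ n)
  rw [div_sub_one hJpos.ne', Real.norm_eq_abs, abs_div, abs_of_pos hJpos]
  exact div_le_div₀ ((abs_nonneg _).trans hn) hn (hL n) (hJ n)

/-- Let `q > 1`, `ρ > 1`, `ρ₀ = (1 + ρ)/2` and let `ν` be a finite
Borel measure on `[0, ρ]` whose topological support contains `ρ`. With
`I n = ∫_0^ρ (U (2n) x - q⁻¹ U (2n-2) x) dν` and
`Ĩ n = ∫_{ρ₀}^ρ (x + √(x² - 1))^(2n)·((x + √(x² - 1))² - q⁻¹)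
        / (2√(x² - 1)·(x + √(x² - 1))) dν`,
one has `Ĩ n → ∞` and `I n / Ĩ n → 1`. -/
theorem chebyshev_integral_asymptotic
    (q : ℝ) (hq : 1 < q) (ρ : ℝ) (hρ : 1 < ρ) (ρ₀ : ℝ) (hρ₀ : ρ₀ = (1 + ρ) / 2)
    (ν : Measure ℝ) [IsFiniteMeasure ν] (hν : ν (Set.Icc 0 ρ)ᶜ = 0)
    (hsupp : ∀ U ∈ nhds ρ, 0 < ν U)
    (I : ℕ → ℝ)
    (hI : ∀ n, I n = ∫ x in Set.Icc 0 ρ,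
      ((Polynomial.Chebyshev.U ℝ (2 * (n : ℤ))).eval x -
        q⁻¹ * (Polynomial.Chebyshev.U ℝ (2 * (n : ℤ) - 2)).eval x) ∂ν)
    (J : ℕ → ℝ)
    (hJ : ∀ n, J n = ∫ x in Set.Icc ρ₀ ρ,
      (x + Real.sqrt (x ^ 2 - 1)) ^ (2 * n) *
        (((x + Real.sqrt (x ^ 2 - 1)) ^ 2 - q⁻¹) /
          (2 * Real.sqrt (x ^ 2 - 1) * (x + Real.sqrt (x ^ 2 - 1)))) ∂ν) :
    Tendsto J atTop atTop ∧
      Tendsto (fun n : ℕ => I n / J n) atTop (nhds 1) := by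
  have hq0 : 0 ≤ q⁻¹ := by positivity
  have hq1 : q⁻¹ < 1 := inv_lt_one_of_one_lt₀ hq
  have hρ₀1 : 1 < ρ₀ := by linarith
  have hρ₀ρ : ρ₀ < ρ := by linarith
  obtain ⟨ρ₁, h01, h1ρ⟩ := exists_between hρ₀ρ
  set t₀ := Real.exp (Real.arcosh ρ₀) with ht₀
  set t₁ := Real.exp (Real.arcosh ρ₁) with ht₁
  have ht₀1 : 1 < t₀ := Real.one_lt_exp_iff.2 (Real.arcosh_pos hρ₀1)
  have ht₀₁ : t₀ < t₁ :=
    Real.exp_lt_exp.2 ((Real.arcosh_lt_arcosh (by linarith) (by linarith)).2 h01)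
  set f : ℕ → ℝ → ℝ := fun n x =>
    (U ℝ (2 * (n : ℤ))).eval x - q⁻¹ * (U ℝ (2 * (n : ℤ) - 2)).eval x with hf
  set g : ℕ → ℝ → ℝ := fun n x => (x + √(x ^ 2 - 1)) ^ (2 * n) *
    (((x + √(x ^ 2 - 1)) ^ 2 - q⁻¹) / (2 * √(x ^ 2 - 1) * (x + √(x ^ 2 - 1)))) with hg
  have hsq : ∀ {x y : ℝ}, 1 < x → x ≤ y → √(x ^ 2 - 1) ≤ √(y ^ 2 - 1) := fun h h' =>
    Real.sqrt_le_sqrt (by nlinarith)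
  have hspos : ∀ {x : ℝ}, 1 < x → 0 < √(x ^ 2 - 1) := fun h => Real.sqrt_pos.2 (by nlinarith)
  have hfint : ∀ n, IntegrableOn (f n) (Set.Icc 0 ρ) ν := fun n =>
    (by fun_prop : Continuous (f n)).continuousOn.integrableOn_compact isCompact_Icc
  have hgint : ∀ n, IntegrableOn (g n) (Set.Icc ρ₀ ρ) ν := by
    intro n
    refine ContinuousOn.integrableOn_compact isCompact_Icc ?_
    refine ContinuousOn.mul (by fun_prop) (ContinuousOn.div (by fun_prop) (by fun_prop) ?_)
    intro x hx
    have hx1 : 1 < x := hρ₀1.trans_le hx.1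
    have := hspos hx1
    positivity
  set κ := (1 - q⁻¹) / (2 * √(ρ ^ 2 - 1) * (ρ + √(ρ ^ 2 - 1))) with hκ
  have hκpos : 0 < κ := by
    have := hspos hρ
    exact div_pos (by linarith) (by positivity)
  have hg_lower : ∀ n, ∀ y, 1 < y → ∀ x ∈ Set.Icc y ρ,
      Real.exp (Real.arcosh y) ^ (2 * n) * κ ≤ g n x := by
    intro n y hy x hx
    have hx1 : 1 < x := hy.trans_le hx.1
    have hsx := hspos hx1
    have hle := hsq hx1 hx.2
    have hle' := hsq hy hx.1
    have hxρ := hx.2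
    have hyx := hx.1
    rw [Real.exp_arcosh hy.le]
    have hone : 1 ≤ (x + √(x ^ 2 - 1)) ^ 2 := one_le_pow₀ (by linarith)
    simp only [hg, hκ]
    gcongr
    linarith
  have hν₁ : 0 < ν.real (Set.Icc ρ₁ ρ) := by
    rw [measureReal_def, ENNReal.toReal_pos_iff]
    refine ⟨?_, measure_lt_top _ _⟩
    refine (hsupp _ (Ioi_mem_nhds h1ρ)).trans_le ?_
    have : Set.Ioi ρ₁ ⊆ Set.Icc ρ₁ ρ ∪ (Set.Icc 0 ρ)ᶜ := by
      intro x hx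
      rcases le_or_gt x ρ with h | h
      · exact Or.inl ⟨le_of_lt hx, h⟩
      · exact Or.inr fun h' => absurd h'.2 (not_le.2 h)
    calc ν (Set.Ioi ρ₁) ≤ ν (Set.Icc ρ₁ ρ) + ν (Set.Icc 0 ρ)ᶜ :=
          (measure_mono this).trans (measure_union_le _ _)
      _ = ν (Set.Icc ρ₁ ρ) := by rw [hν, add_zero]
  have hJ_lower : ∀ n, t₁ ^ (2 * n) * κ * ν.real (Set.Icc ρ₁ ρ) ≤ J n := by
    intro n
    have hsub : Set.Icc ρ₁ ρ ⊆ Set.Icc ρ₀ ρ := Set.Icc_subset_Icc_left h01.le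
    rw [hJ]
    calc _ ≤ ∫ x in Set.Icc ρ₁ ρ, g n x ∂ν :=
          setIntegral_ge_of_const_le_real measurableSet_Icc (measure_ne_top _ _)
            (hg_lower n ρ₁ (by linarith)) ((hgint n).mono_set hsub)
      _ ≤ ∫ x in Set.Icc ρ₀ ρ, g n x ∂ν := by
          refine setIntegral_mono_set (hgint n) ?_ hsub.eventuallyLE
          filter_upwards [ae_restrict_mem measurableSet_Icc] with x hx
          exact (by positivity : (0 : ℝ) ≤ t₀ ^ (2 * n) * κ).trans (hg_lower n ρ₀ hρ₀1 x hx)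
  have hL : ∀ n : ℕ, 0 < t₁ ^ (2 * n) * κ * ν.real (Set.Icc ρ₁ ρ) := fun n => by positivity
  have hIJ : ∀ᶠ n : ℕ in atTop, |I n - J n| ≤
      2 * ((2 * n + 1) * t₀ ^ (2 * n)) * ν.real (Set.Ico 0 ρ₀)
        + 1 / (2 * √(ρ₀ ^ 2 - 1)) * ν.real (Set.Icc ρ₀ ρ) := by
    filter_upwards [eventually_ge_atTop 1] with n hn
    obtain ⟨k, rfl⟩ := Nat.exists_eq_add_of_le' hn
    have hunion : Set.Icc 0 ρ = Set.Ico 0 ρ₀ ∪ Set.Icc ρ₀ ρ :=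
      (Set.Ico_union_Icc_eq_Icc (by linarith) hρ₀ρ.le).symm
    have hfi := hfint (k + 1)
    have hsplit : I (k + 1) - J (k + 1) =
        ∫ x in Set.Ico 0 ρ₀, f (k + 1) x ∂ν +
          ∫ x in Set.Icc ρ₀ ρ, (f (k + 1) x - g (k + 1) x) ∂ν := by
      rw [hunion] at hfi
      rw [hI, hJ, hunion, setIntegral_union _ measurableSet_Icc hfi.left_of_union
        hfi.right_of_union, integral_sub hfi.right_of_union (hgint _), add_sub_assoc]
      exact Set.disjoint_left.2 fun x hx hx' => absurd hx.2 (not_lt.2 hx'.1)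
    rw [hsplit]
    refine (abs_add_le _ _).trans (add_le_add ?_ ?_)
    · rw [← Real.norm_eq_abs]
      refine norm_setIntegral_le_of_norm_le_const (measure_lt_top _ _) fun x hx => ?_
      have hx' : -1 ≤ x := by linarith [hx.1]
      have b1 := abs_eval_U_le_mul_exp_arcosh_pow (2 * (k + 1)) hx' hx.2.le hρ₀1.le
      have b2 := abs_eval_U_le_mul_exp_arcosh_pow (2 * k) hx' hx.2.le hρ₀1.le
      have hidx : 2 * ((k + 1 : ℕ) : ℤ) - 2 = ((2 * k : ℕ) : ℤ) := by push_cast; ring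
      have hidx' : 2 * ((k + 1 : ℕ) : ℤ) = ((2 * (k + 1) : ℕ) : ℤ) := by push_cast; ring
      rw [← ht₀] at b1 b2
      have b3 : (((2 * k : ℕ) : ℝ) + 1) * t₀ ^ (2 * k) ≤
          (((2 * (k + 1) : ℕ) : ℝ) + 1) * t₀ ^ (2 * (k + 1)) := by
        gcongr <;> linarith
      simp only [hf, Real.norm_eq_abs]
      rw [hidx, hidx']
      refine (abs_sub _ _).trans ?_
      rw [abs_mul, abs_of_nonneg hq0]
      have b4 := mul_le_of_le_one_left (abs_nonneg ((U ℝ ((2 * k : ℕ) : ℤ)).eval x)) hq1.le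
      push_cast at b1 b2 b3 b4 ⊢
      linarith
    · rw [← Real.norm_eq_abs]
      refine norm_setIntegral_le_of_norm_le_const (measure_lt_top _ _) fun x hx => ?_
      have hx1 : 1 < x := hρ₀1.trans_le hx.1
      refine (abs_eval_U_sub_le_inv_sqrt k hq0 hq1.le hx1).trans ?_
      have := hspos hρ₀1
      have := hsq hρ₀1 hx.1
      gcongr
  refine ⟨tendsto_atTop_mono hJ_lower ?_, tendsto_div_one_of_abs_sub_le hL hJ_lower hIJ ?_⟩
  · simp only [pow_mul, mul_assoc]
    exact (tendsto_pow_atTop_atTop_of_one_lt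
      (one_lt_pow₀ (ht₀1.trans ht₀₁) two_ne_zero)).atTop_mul_const (by positivity)
  · have h := (tendsto_linear_mul_pow_add_div_pow ht₀1.le ht₀₁ (2 * ν.real (Set.Ico 0 ρ₀))
      (1 / (2 * √(ρ₀ ^ 2 - 1)) * ν.real (Set.Icc ρ₀ ρ))).div_const
      (κ * ν.real (Set.Icc ρ₁ ρ))
    rw [zero_div] at h
    refine h.congr fun n => ?_
    rw [div_div, mul_assoc (t₁ ^ (2 * n))]
    congr 2
    ring
end
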